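/- (Naruse's hook-length formula, type D.) Let λ and μ be strict partitions with μ ⊆ λ. Then, as an identity of rational numbers, f^{λ/μ} = |λ/μ|! · Σ_{D ∈ E^D(λ/μ)} ∏_{u ∈ [λ]^D ∖ D} 1/h^D(u), where |λ/μ| = |λ| − |μ|. -/

import Mathlib

attribute [local instance] Classical.propDecidable

/-- `l : ℕ → ℕ` encodes a strict partition: the parts are `l 1 > l 2 > ⋯ > l ℓ > 0`
(indexed from `1`), with `l i = 0` for `i > ℓ` (and `l 0 = 0` by convention). -/
def IsStrictPartition (l : ℕ → ℕ) : Prop :=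
  l 0 = 0 ∧ ∀ i, 1 ≤ i → (l i = 0 → l (i + 1) = 0) ∧ (l i ≠ 0 → l (i + 1) < l i)

/-- The shifted diagram of type B: cells `(i,j)` with `1 ≤ i ≤ ℓ(λ)` and
`i ≤ j ≤ λ_i + i - 1`.  (For a strict partition all such cells satisfy
`i ≤ l 1` and `j ≤ 2 * l 1 + 2`, so the ambient box loses nothing.) -/
noncomputable def cellsB (l : ℕ → ℕ) : Finset (ℕ × ℕ) :=
  (Finset.Icc 1 (l 1) ×ˢ Finset.Icc 1 (2 * l 1 + 2)).filter
    (fun p => p.1 ≤ p.2 ∧ p.2 < l p.1 + p.1)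

/-- The shifted diagram of type D: cells `(i,j)` with `1 ≤ i ≤ ℓ(λ)` and
`i + 1 ≤ j ≤ λ_i + i`. -/
noncomputable def cellsD (l : ℕ → ℕ) : Finset (ℕ × ℕ) :=
  (Finset.Icc 1 (l 1) ×ˢ Finset.Icc 1 (2 * l 1 + 2)).filter
    (fun p => p.1 < p.2 ∧ p.2 ≤ l p.1 + p.1)

/-- `λ'_k`: the number of cells of `[λ]^B` in column `k`. -/
noncomputable def colB (l : ℕ → ℕ) (k : ℕ) : ℕ :=
  ((cellsB l).filter (fun p => p.2 = k)).card

/-- The size `|λ|` of a strict partition. -/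
noncomputable def spSize (l : ℕ → ℕ) : ℕ := ∑ i ∈ Finset.Icc 1 (l 1), l i

/-- The length `ℓ(λ)` (number of nonzero parts) of a strict partition. -/
noncomputable def spLength (l : ℕ → ℕ) : ℕ :=
  ((Finset.Icc 1 (l 1)).filter (fun i => l i ≠ 0)).card

/-- `μ ⋖ ν` for strict partitions (containment via type B diagrams and `|ν| = |μ| + 1`). -/
def CoversB (m n : ℕ → ℕ) : Prop :=
  cellsB m ⊆ cellsB n ∧ spSize n = spSize m + 1

/-- `μ ⋖ ν` for strict partitions (containment via type D diagrams and `|ν| = |μ| + 1`). -/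
def CoversD (m n : ℕ → ℕ) : Prop :=
  cellsD m ⊆ cellsD n ∧ spSize n = spSize m + 1

/-- An excited move of type B with respect to `λ`. -/
def ExcitedMoveB (l : ℕ → ℕ) (D D' : Finset (ℕ × ℕ)) : Prop :=
  ∃ i j : ℕ, (i, j) ∈ D ∧
    (i + 1, j) ∈ cellsB l ∧ (i + 1, j) ∉ D ∧
    (i, j + 1) ∈ cellsB l ∧ (i, j + 1) ∉ D ∧
    (i + 1, j + 1) ∈ cellsB l ∧ (i + 1, j + 1) ∉ D ∧
    D' = insert (i + 1, j + 1) (D.erase (i, j))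

/-- The excited diagrams of type B of shape `λ/μ`: subsets of `[λ]^B` obtainable from
`[μ]^B` by finite sequences of excited moves of type B. -/
noncomputable def EB (l m : ℕ → ℕ) : Finset (Finset (ℕ × ℕ)) :=
  (cellsB l).powerset.filter
    (fun D => Relation.ReflTransGen (ExcitedMoveB l) (cellsB m) D)

/-- An excited move of type D with respect to `λ`. -/
def ExcitedMoveD (l : ℕ → ℕ) (D D' : Finset (ℕ × ℕ)) : Prop :=
  (∃ i j : ℕ, i + 1 < j ∧ (i, j) ∈ D ∧
    (i + 1, j) ∈ cellsD l ∧ (i + 1, j) ∉ D ∧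
    (i, j + 1) ∈ cellsD l ∧ (i, j + 1) ∉ D ∧
    (i + 1, j + 1) ∈ cellsD l ∧ (i + 1, j + 1) ∉ D ∧
    D' = insert (i + 1, j + 1) (D.erase (i, j))) ∨
  (∃ i : ℕ, (i, i + 1) ∈ D ∧
    (i, i + 2) ∈ cellsD l ∧ (i, i + 2) ∉ D ∧
    (i, i + 3) ∈ cellsD l ∧ (i, i + 3) ∉ D ∧
    (i + 1, i + 2) ∈ cellsD l ∧ (i + 1, i + 2) ∉ D ∧
    (i + 1, i + 3) ∈ cellsD l ∧ (i + 1, i + 3) ∉ D ∧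
    (i + 2, i + 3) ∈ cellsD l ∧ (i + 2, i + 3) ∉ D ∧
    D' = insert (i + 2, i + 3) (D.erase (i, i + 1)))

/-- The excited diagrams of type D of shape `λ/μ`. -/
noncomputable def ED (l m : ℕ → ℕ) : Finset (Finset (ℕ × ℕ)) :=
  (cellsD l).powerset.filter
    (fun D => Relation.ReflTransGen (ExcitedMoveD l) (cellsD m) D)

/-- The set `W^B(μ, λ)`: all `1 ≤ k ≤ ℓ(λ)` with `λ_k ≠ μ_i` for all `i ≥ 1`, together
with all `k ≥ ℓ(λ) + 1` with `λ'_k - k ≠ μ'_i - i` for all `i ≥ 1`.  (All its elements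
are at most `λ_1 + μ_1 + 2`, so the ambient interval loses nothing.) -/
noncomputable def WB (m l : ℕ → ℕ) : Finset ℕ :=
  (Finset.Icc 1 (l 1 + m 1 + 2)).filter (fun k =>
    (k ≤ spLength l ∧ ∀ i, 1 ≤ i → l k ≠ m i) ∨
    (spLength l + 1 ≤ k ∧ ∀ i, 1 ≤ i → (colB l k : ℤ) - k ≠ (colB m i : ℤ) - i))

/-- The set `W^D(μ, λ)`. -/
noncomputable def WD (m l : ℕ → ℕ) : Finset ℕ :=
  (Finset.Icc 1 (l 1 + m 1 + 3)).filter (fun k =>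
    (k ≤ spLength l ∧ ∀ i, 1 ≤ i → l k ≠ m i) ∨
    (k = spLength l + 1 ∧ Odd ((spLength l : ℤ) - (spLength m : ℤ))) ∨
    (spLength l + 2 ≤ k ∧ ∀ i, 1 ≤ i → (colB l k : ℤ) - k ≠ (colB m i : ℤ) - i))

/-- The type B hook length of a cell of `[λ]^B`. -/
noncomputable def hB (l : ℕ → ℕ) (p : ℕ × ℕ) : ℤ :=
  if p.1 = p.2 then (l p.1 : ℤ)
  else if p.2 ≤ spLength l then (l p.1 : ℤ) + (l p.2 : ℤ)
  else ((l p.1 : ℤ) + (p.1 : ℤ) - (p.2 : ℤ)) + ((colB l p.2 : ℤ) - (p.1 : ℤ))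

/-- The type D hook length of a cell of `[λ]^D`. -/
noncomputable def hD (l : ℕ → ℕ) (p : ℕ × ℕ) : ℤ :=
  if p.2 ≤ spLength l then (l p.1 : ℤ) + (l p.2 : ℤ)
  else ((l p.1 : ℤ) + (p.1 : ℤ) - (p.2 : ℤ) + 1) + ((colB l (p.2 - 1) : ℤ) - (p.1 : ℤ))

/-- A standard Young tableau on a finite set of cells, encoded as `T : ℕ × ℕ → ℕ`
which is `0` off the cells and restricts to a bijection onto `{1, …, n}`,
increasing along rows and columns. -/
def IsSYT (cells : Finset (ℕ × ℕ)) (T : ℕ × ℕ → ℕ) : Prop :=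
  Set.BijOn T ↑cells ↑(Finset.Icc 1 cells.card) ∧
  (∀ p, p ∉ cells → T p = 0) ∧
  (∀ i j : ℕ, (i, j) ∈ cells → (i, j + 1) ∈ cells → T (i, j) < T (i, j + 1)) ∧
  (∀ i j : ℕ, (i, j) ∈ cells → (i + 1, j) ∈ cells → T (i, j) < T (i + 1, j))

/-- The skew diagram `[λ]^B ∖ [μ]^B`. -/
noncomputable def skewB (l m : ℕ → ℕ) : Finset (ℕ × ℕ) := cellsB l \ cellsB m

/-- The skew diagram `[λ]^D ∖ [μ]^D`. -/
noncomputable def skewD (l m : ℕ → ℕ) : Finset (ℕ × ℕ) := cellsD l \ cellsD m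

/-- `f^{λ/μ}`: the number of standard Young tableaux of shifted skew shape `λ/μ`
(type B diagrams). -/
noncomputable def fB (l m : ℕ → ℕ) : ℕ :=
  Nat.card {T : ℕ × ℕ → ℕ // IsSYT (skewB l m) T}

/-- `f^{λ/μ}` via the type D diagrams. -/
noncomputable def fD (l m : ℕ → ℕ) : ℕ :=
  Nat.card {T : ℕ × ℕ → ℕ // IsSYT (skewD l m) T}

/-- `x_k^B = λ_k` for `k ≤ ℓ(λ)` and `x_k^B = λ'_k - k` for `k > ℓ(λ)`. -/
noncomputable def xB (l : ℕ → ℕ) (k : ℕ) : ℤ :=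
  if k ≤ spLength l then (l k : ℤ) else (colB l k : ℤ) - (k : ℤ)

/-- `x_k^D = λ_k` for `k ≤ ℓ(λ)` and `x_k^D = λ'_{k-1} - k + 1` for `k > ℓ(λ)`. -/
noncomputable def xD (l : ℕ → ℕ) (k : ℕ) : ℤ :=
  if k ≤ spLength l then (l k : ℤ) else (colB l (k - 1) : ℤ) - (k : ℤ) + 1

/-- The weighted type B hook length `h^B(u; z)`: the sum of `z_{c(v)}` over the cells `v`
of the type B hook of `u` (the diagonal cell `(j,j)` counted twice when `i < j ≤ ℓ(λ)`). -/
noncomputable def hBz (l : ℕ → ℕ) (z : ℕ → ℝ) (u : ℕ × ℕ) : ℝ :=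
  (∑ p ∈ (cellsB l).filter (fun p => p.1 = u.1 ∧ u.2 ≤ p.2), z (p.2 - p.1)) +
  (∑ p ∈ (cellsB l).filter (fun p => p.2 = u.2 ∧ u.1 < p.1), z (p.2 - p.1)) +
  (if u.1 < u.2 ∧ u.2 ≤ spLength l then
      ∑ p ∈ (cellsB l).filter (fun p => p.1 = u.2), z (p.2 - p.1)
    else 0)

/-- The weighted type D hook length `h^D(u; z)`. -/
noncomputable def hDz (l : ℕ → ℕ) (z : ℕ → ℝ) (u : ℕ × ℕ) : ℝ :=
  (∑ p ∈ (cellsD l).filter (fun p => p.1 = u.1 ∧ u.2 ≤ p.2), z (p.2 - p.1)) +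
  (∑ p ∈ (cellsD l).filter (fun p => p.2 = u.2 ∧ u.1 < p.1), z (p.2 - p.1)) +
  (∑ p ∈ (cellsD l).filter (fun p => p.1 = u.2), z (p.2 - p.1))

/-- The weight `T_z` of a standard Young tableau `T` on `cells` (with `n = |cells|`):
`∏_{k=1}^n (z_{c(T⁻¹(n))} + ⋯ + z_{c(T⁻¹(k))})⁻¹`. -/
noncomputable def Tz (cells : Finset (ℕ × ℕ)) (z : ℕ → ℝ) (T : ℕ × ℕ → ℕ) : ℝ :=
  ∏ k ∈ Finset.Icc 1 cells.card,
    (∑ p ∈ cells.filter (fun p => k ≤ T p), z (p.2 - p.1))⁻¹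

/-- `x_k^B(z) = z_0 + ⋯ + z_{λ_k - 1}` for `k ≤ ℓ(λ)`, and
`x_k^B(z) = -(z_0 + ⋯ + z_{k - λ'_k - 1})` for `k > ℓ(λ)`. -/
noncomputable def xBz (l : ℕ → ℕ) (z : ℕ → ℝ) (k : ℕ) : ℝ :=
  if k ≤ spLength l then ∑ t ∈ Finset.range (l k), z t
  else -∑ t ∈ Finset.range (k - colB l k), z t


/-- Order ideals of the shifted poset. -/
def Idl (M : Finset (ℕ × ℕ)) : Prop :=
  (∀ i j, (i, j) ∈ M → 1 ≤ i ∧ i < j) ∧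
  (∀ i j, i < j → (i, j + 1) ∈ M → (i, j) ∈ M) ∧
  (∀ i j, 1 ≤ i → (i + 1, j) ∈ M → (i, j) ∈ M)

theorem Idl.down {M : Finset (ℕ × ℕ)} (h : Idl M) {i j i' j' : ℕ} (hm : (i', j') ∈ M)
    (h1 : 1 ≤ i) (hi : i ≤ i') (hij : i < j) (hj : j ≤ j') : (i, j) ∈ M := by
  have a : ∀ k, ∀ i, 1 ≤ i → (i + k, j') ∈ M → (i, j') ∈ M := by
    intro k
    induction k with
    | zero => intro i _ h; exact h
    | succ k ih =>
      intro i hi hm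
      exact ih i hi (h.2.2 (i + k) j' (by omega) hm)
  have b : ∀ k, ∀ j, i < j → (i, j + k) ∈ M → (i, j) ∈ M := by
    intro k
    induction k with
    | zero => intro i _ h; exact h
    | succ k ih =>
      intro j hj hm
      exact ih j hj (h.2.1 i (j + k) (by omega) hm)
  obtain ⟨k, rfl⟩ := Nat.exists_eq_add_of_le hi
  obtain ⟨k', rfl⟩ := Nat.exists_eq_add_of_le hj
  exact b k' j hij (a k i h1 hm)

theorem Idl.inter {M N : Finset (ℕ × ℕ)} (h : Idl M) (h' : Idl N) : Idl (M ∩ N) := by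
  refine ⟨fun i j hm => h.1 i j (Finset.mem_inter.1 hm).1, fun i j hij hm => ?_,
    fun i j hij hm => ?_⟩ <;> rw [Finset.mem_inter] at hm ⊢
  · exact ⟨h.2.1 i j hij hm.1, h'.2.1 i j hij hm.2⟩
  · exact ⟨h.2.2 i j hij hm.1, h'.2.2 i j hij hm.2⟩

theorem Idl.union {M N : Finset (ℕ × ℕ)} (h : Idl M) (h' : Idl N) : Idl (M ∪ N) := by
  refine ⟨fun i j hm => ?_, fun i j hij hm => ?_,
    fun i j hij hm => ?_⟩ <;> rw [Finset.mem_union] at hm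
  · exact hm.elim (h.1 i j) (h'.1 i j)
  · rw [Finset.mem_union]; exact hm.imp (h.2.1 i j hij) (h'.2.1 i j hij)
  · rw [Finset.mem_union]; exact hm.imp (h.2.2 i j hij) (h'.2.2 i j hij)

def Addb (M : Finset (ℕ × ℕ)) (a : ℕ × ℕ) : Prop := a ∉ M ∧ Idl (insert a M)
def Remb (M : Finset (ℕ × ℕ)) (b : ℕ × ℕ) : Prop := b ∈ M ∧ Idl (M.erase b)

/-- same node of the Dynkin diagram -/
def Same (b c : ℕ × ℕ) : Prop :=
  b.2 + c.1 = c.2 + b.1 ∧ (c.2 = c.1 + 1 → b.1 % 2 = c.1 % 2)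

/-- Excited moves with arbitrary ambient set. -/
def Mv (L D D' : Finset (ℕ × ℕ)) : Prop :=
  (∃ i j : ℕ, i + 1 < j ∧ (i, j) ∈ D ∧
    (i + 1, j) ∈ L ∧ (i + 1, j) ∉ D ∧
    (i, j + 1) ∈ L ∧ (i, j + 1) ∉ D ∧
    (i + 1, j + 1) ∈ L ∧ (i + 1, j + 1) ∉ D ∧
    D' = insert (i + 1, j + 1) (D.erase (i, j))) ∨
  (∃ i : ℕ, (i, i + 1) ∈ D ∧
    (i, i + 2) ∈ L ∧ (i, i + 2) ∉ D ∧
    (i, i + 3) ∈ L ∧ (i, i + 3) ∉ D ∧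
    (i + 1, i + 2) ∈ L ∧ (i + 1, i + 2) ∉ D ∧
    (i + 1, i + 3) ∈ L ∧ (i + 1, i + 3) ∉ D ∧
    (i + 2, i + 3) ∈ L ∧ (i + 2, i + 3) ∉ D ∧
    D' = insert (i + 2, i + 3) (D.erase (i, i + 1)))

noncomputable def EE (L M : Finset (ℕ × ℕ)) : Finset (Finset (ℕ × ℕ)) :=
  L.powerset.filter (fun D => Relation.ReflTransGen (Mv L) M D)

theorem mem_EE {L M D : Finset (ℕ × ℕ)} :
    D ∈ EE L M ↔ D ⊆ L ∧ Relation.ReflTransGen (Mv L) M D := by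
  simp [EE]

theorem ED_eq (l m : ℕ → ℕ) : ED l m = EE (cellsD l) (cellsD m) := rfl

theorem Mv.mono {L L' D D' : Finset (ℕ × ℕ)} (h : L' ⊆ L) (hm : Mv L' D D') : Mv L D D' := by
  rcases hm with ⟨i, j, h1, h2, h3, h4, h5, h6, h7, h8, h9⟩ |
    ⟨i, h2, h3, h4, h5, h6, h7, h8, h9, h10, h11, h12, h13⟩
  · exact Or.inl ⟨i, j, h1, h2, h h3, h4, h h5, h6, h h7, h8, h9⟩
  · exact Or.inr ⟨i, h2, h h3, h4, h h5, h6, h h7, h8, h h9, h10, h h11, h12, h13⟩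

theorem chain_mono {L L' M D : Finset (ℕ × ℕ)} (h : L' ⊆ L)
    (hc : Relation.ReflTransGen (Mv L') M D) : Relation.ReflTransGen (Mv L) M D := by
  induction hc with
  | refl => exact Relation.ReflTransGen.refl
  | tail _ hs ih => exact ih.tail (Mv.mono h hs)

theorem EE_mono {L L' M : Finset (ℕ × ℕ)} (h : L' ⊆ L) : EE L' M ⊆ EE L M := by
  intro D hD
  rw [mem_EE] at hD ⊢
  exact ⟨hD.1.trans h, chain_mono h hD.2⟩

theorem EE_empty {L M : Finset (ℕ × ℕ)} (hL : Idl L) (hM : Idl M) (h : ¬ M ⊆ L) : EE L M = ∅ := by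
  rw [Finset.not_subset] at h
  obtain ⟨u, hu, huL⟩ := h
  rw [Finset.eq_empty_iff_forall_notMem]
  intro D hD
  rw [mem_EE] at hD
  have : u ∈ D := by
    have h2 := hD.2
    clear hD
    induction h2 with
    | refl => exact hu
    | tail _ hs ih =>
      rcases hs with ⟨i, j, h1, h2, h3, h4, h5, h6, h7, h8, rfl⟩ |
        ⟨i, h2, h3, h4, h5, h6, h7, h8, h9, h10, h11, h12, rfl⟩
      · refine Finset.mem_insert_of_mem (Finset.mem_erase.2 ⟨?_, ih⟩)
        rintro rfl
        exact huL (hL.2.1 _ _ (by omega) h5)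
      · refine Finset.mem_insert_of_mem (Finset.mem_erase.2 ⟨?_, ih⟩)
        rintro rfl
        exact huL (hL.2.1 _ _ (by omega) h3)
  exact huL (hD.1 this)

/-- c is a corner of L. -/
theorem Remb.right {L : Finset (ℕ × ℕ)} (hL : Idl L) {p q : ℕ} (hc : Remb L (p, q)) :
    (p, q + 1) ∉ L := by
  intro h
  have := hc.2.2.1 p q (hL.1 p q hc.1).2 (Finset.mem_erase.2 ⟨by simp, h⟩)
  simp at this

theorem Remb.below {L : Finset (ℕ × ℕ)} (hL : Idl L) {p q : ℕ} (hc : Remb L (p, q)) :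
    (p + 1, q) ∉ L := by
  intro h
  have := hc.2.2.2 p q (hL.1 p q hc.1).1 (Finset.mem_erase.2 ⟨by simp, h⟩)
  simp at this

theorem chain_restrict {L M D : Finset (ℕ × ℕ)} (hL : Idl L) {c : ℕ × ℕ} (hc : Remb L c)
    (h : Relation.ReflTransGen (Mv L) M D) :
    c ∉ D → Relation.ReflTransGen (Mv (L.erase c)) M D := by
  obtain ⟨p, q⟩ := c
  have r := hc.right hL
  have b := hc.below hL
  have key : ∀ x y : ℕ, (x, y) ∈ L → ((x, y + 1) ∈ L ∨ (x + 1, y) ∈ L) →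
      (x, y) ∈ L.erase (p, q) := by
    intro x y h1 h2
    refine Finset.mem_erase.2 ⟨?_, h1⟩
    intro he
    simp only [Prod.mk.injEq] at he
    obtain ⟨rfl, rfl⟩ := he
    exact h2.elim r b
  have key2 : ∀ (x y : ℕ) (D : Finset (ℕ × ℕ)), (x, y) ∈ L → (p, q) ∉ insert (x, y) D →
      (x, y) ∈ L.erase (p, q) := by
    intro x y D h1 h2
    refine Finset.mem_erase.2 ⟨?_, h1⟩
    intro he
    rw [he] at h2
    simp at h2
  induction h with
  | refl => intro _; exact Relation.ReflTransGen.refl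
  | tail _ hs ih =>
    intro hn
    rcases hs with ⟨i, j, h1, h2, h3, h4, h5, h6, h7, h8, rfl⟩ |
        ⟨i, h2, h3, h4, h5, h6, h7, h8, h9, h10, h11, h12, rfl⟩
    · refine Relation.ReflTransGen.tail (ih ?_) (Or.inl ⟨i, j, h1, h2, key _ _ h3 (Or.inl h7), h4,
        key _ _ h5 (Or.inr h7), h6, key2 _ _ _ h7 hn, h8, rfl⟩)
      intro hD
      apply hn
      refine Finset.mem_insert_of_mem (Finset.mem_erase.2 ⟨?_, hD⟩)
      intro he
      simp only [Prod.mk.injEq] at he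
      obtain ⟨rfl, rfl⟩ := he
      exact r h5
    · refine Relation.ReflTransGen.tail (ih ?_) (Or.inr ⟨i, h2, key _ _ h3 (Or.inl h5), h4,
        key _ _ h5 (Or.inr h9), h6, key _ _ h7 (Or.inl h9), h8, key _ _ h9 (Or.inr h11), h10,
        key2 _ _ _ h11 hn, h12, rfl⟩)
      intro hD
      apply hn
      refine Finset.mem_insert_of_mem (Finset.mem_erase.2 ⟨?_, hD⟩)
      intro he
      simp only [Prod.mk.injEq] at he
      obtain ⟨rfl, rfl⟩ := he
      exact r h3

theorem chain_insert {L M D : Finset (ℕ × ℕ)} (hL : Idl L) {c : ℕ × ℕ} (hc : Remb L c)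
    (h : Relation.ReflTransGen (Mv (L.erase c)) M D) :
    Relation.ReflTransGen (Mv L) (insert c M) (insert c D) := by
  have r : (c.1, c.2 + 1) ∉ L := hc.right hL
  have key : ∀ (x : ℕ × ℕ) (D : Finset (ℕ × ℕ)), x ∈ L.erase c → x ∉ D → x ∉ insert c D := by
    intro x D h1 h2
    simp only [Finset.mem_insert, not_or]
    exact ⟨(Finset.mem_erase.1 h1).1, h2⟩
  have key2 : ∀ (x y : ℕ), (x, y + 1) ∈ L.erase c → c ≠ (x, y) := by
    rintro x y h1 rfl
    exact r (Finset.mem_of_mem_erase h1)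
  induction h with
  | refl => exact Relation.ReflTransGen.refl
  | tail _ hs ih =>
    refine ih.tail ?_
    have me : ∀ x, x ∈ L.erase c → x ∈ L := fun x => Finset.mem_of_mem_erase
    rcases hs with ⟨i, j, h1, h2, h3, h4, h5, h6, h7, h8, rfl⟩ |
        ⟨i, h2, h3, h4, h5, h6, h7, h8, h9, h10, h11, h12, rfl⟩
    · refine Or.inl ⟨i, j, h1, Finset.mem_insert_of_mem h2, me _ h3, key _ _ h3 h4, me _ h5,
        key _ _ h5 h6, me _ h7, key _ _ h7 h8, ?_⟩
      rw [Finset.erase_insert_of_ne (key2 _ _ h5), Finset.insert_comm]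
    · refine Or.inr ⟨i, Finset.mem_insert_of_mem h2, me _ h3, key _ _ h3 h4, me _ h5,
        key _ _ h5 h6, me _ h7, key _ _ h7 h8, me _ h9, key _ _ h9 h10, me _ h11,
        key _ _ h11 h12, ?_⟩
      rw [Finset.erase_insert_of_ne (key2 _ _ h3), Finset.insert_comm]

/-- moving a removable box down to the corner -/
theorem chain_slide {L M : Finset (ℕ × ℕ)} (hL : Idl L) (hM : Idl M) (hML : M ⊆ L)
    {b c : ℕ × ℕ} (hc : Remb L c) (hb : Remb M b) (hs : Same b c) :
    Relation.ReflTransGen (Mv L) M (insert c (M.erase b)) := by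
  obtain ⟨p, q⟩ := c
  obtain ⟨i, j⟩ := b
  obtain ⟨hs1, hs2⟩ := hs
  simp only at hs1 hs2
  have hcL := hL.1 _ _ hc.1
  have hbM := hM.1 _ _ hb.1
  have r := hc.right hL
  have mr := hb.right hM
  have mb := hb.below hM
  have hip : i ≤ p := by
    by_contra hlt
    exact r (hL.down (hML hb.1) hcL.1 (by omega) (by omega) (by omega))
  -- cells beyond b are not in M
  have out : ∀ x y, x < y → i ≤ x → j ≤ y → (x, y) ≠ (i, j) → (x, y) ∉ M := by
    intro x y hxy hx hy hne hm
    rcases Nat.lt_or_ge j y with h | h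
    · exact mr (hM.down hm hbM.1 hx (by omega) h)
    · have hyj : y = j := by omega
      subst hyj
      have : x ≠ i := by rintro rfl; exact hne rfl
      exact mb (hM.down hm (by omega) (by omega) (by omega) le_rfl)
  have inL : ∀ x y, x < y → i ≤ x → x ≤ p → y ≤ q → (x, y) ∈ L := by
    intro x y h1 h2 h3 h4
    exact hL.down hc.1 (by omega) h3 h1 h4
  have out2 : ∀ s x y, x < y → i + s ≤ x → j + s ≤ y → (x, y) ≠ (i + s, j + s) →
      (x, y) ∉ insert (i + s, j + s) (M.erase (i, j)) := by
    intro s x y h1 h2 h3 h4 h5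
    rcases Finset.mem_insert.1 h5 with h5 | h5
    · exact h4 h5
    · exact out x y h1 (by omega) (by omega) (Finset.mem_erase.1 h5).1 (Finset.mem_erase.1 h5).2
  have er : ∀ s, (insert (i + s, j + s) (M.erase (i, j))).erase (i + s, j + s) =
      M.erase (i, j) := by
    intro s
    rw [Finset.erase_insert]
    intro h5
    exact out _ _ (by omega) (by omega) (by omega) (Finset.mem_erase.1 h5).1
      (Finset.mem_erase.1 h5).2
  by_cases hd : j = i + 1
  · subst hd
    have main : ∀ s, i + 2 * s ≤ p → Relation.ReflTransGen (Mv L) M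
        (insert (i + 2 * s, i + 1 + 2 * s) (M.erase (i, i + 1))) := by
      intro s
      induction s with
      | zero =>
        intro _
        simp only [Nat.mul_zero, Nat.add_zero]
        rw [Finset.insert_erase hb.1]
      | succ s ih =>
        intro hp
        refine (ih (by omega)).tail (Or.inr ⟨i + 2 * s, ?_, ?_, ?_, ?_, ?_, ?_, ?_, ?_, ?_, ?_, ?_,
          ?_⟩)
        · rw [show i + 2 * s + 1 = i + 1 + 2 * s by omega]
          exact Finset.mem_insert_self _ _
        · exact inL _ _ (by omega) (by omega) (by omega) (by omega)
        · exact out2 _ _ _ (by omega) (by omega) (by omega) (by simp; omega)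
        · exact inL _ _ (by omega) (by omega) (by omega) (by omega)
        · exact out2 _ _ _ (by omega) (by omega) (by omega) (by simp; omega)
        · exact inL _ _ (by omega) (by omega) (by omega) (by omega)
        · exact out2 _ _ _ (by omega) (by omega) (by omega) (by simp)
        · exact inL _ _ (by omega) (by omega) (by omega) (by omega)
        · exact out2 _ _ _ (by omega) (by omega) (by omega) (by simp)
        · exact inL _ _ (by omega) (by omega) (by omega) (by omega)
        · exact out2 _ _ _ (by omega) (by omega) (by omega) (by simp)
        · rw [show i + 2 * s + 1 = i + 1 + 2 * s by omega, er (2 * s)]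
          congr 2
          omega
    have := main ((p - i) / 2) (by omega)
    have h2 := hs2 (by omega)
    rwa [show i + 2 * ((p - i) / 2) = p by omega, show i + 1 + 2 * ((p - i) / 2) = q by omega]
      at this
  · have main : ∀ s, i + s ≤ p → Relation.ReflTransGen (Mv L) M
        (insert (i + s, j + s) (M.erase (i, j))) := by
      intro s
      induction s with
      | zero =>
        intro _
        simp only [Nat.add_zero]
        rw [Finset.insert_erase hb.1]
      | succ s ih =>
        intro hp
        refine (ih (by omega)).tail (Or.inl ⟨i + s, j + s, ?_, ?_, ?_, ?_, ?_, ?_, ?_, ?_, ?_⟩)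
        · omega
        · exact Finset.mem_insert_self _ _
        · exact inL _ _ (by omega) (by omega) (by omega) (by omega)
        · exact out2 _ _ _ (by omega) (by omega) (by omega) (by simp)
        · exact inL _ _ (by omega) (by omega) (by omega) (by omega)
        · exact out2 _ _ _ (by omega) (by omega) (by omega) (by simp)
        · exact inL _ _ (by omega) (by omega) (by omega) (by omega)
        · exact out2 _ _ _ (by omega) (by omega) (by omega) (by simp)
        · rw [er s]
          rfl
    have := main (p - i) (by omega)
    rwa [show i + (p - i) = p by omega, show j + (p - i) = q by omega] at this

/-- no cell of D beyond c on the same or adjacent diagonals -/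
def Free (D : Finset (ℕ × ℕ)) (c : ℕ × ℕ) : Prop :=
  ∀ s, (c.1 + s + 1, c.2 + s + 1) ∉ D ∧ (c.1 + s, c.2 + s + 1) ∉ D ∧
    (c.1 + 1 < c.2 → (c.1 + s + 1, c.2 + s) ∉ D)

theorem chain_free {L M D : Finset (ℕ × ℕ)} (hM : Idl M)
    (h : Relation.ReflTransGen (Mv L) M D) : ∀ c, c.1 < c.2 → c ∈ D → Free D c →
    ∃ b, Remb M b ∧ Same b c ∧ Relation.ReflTransGen (Mv L) (M.erase b) (D.erase c) := by
  induction h with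
  | refl =>
    rintro ⟨p, q⟩ hlt hc hf
    refine ⟨(p, q), ⟨hc, ⟨fun i j h => hM.1 i j (Finset.mem_of_mem_erase h),
      fun i j hij h => ?_, fun i j hi h => ?_⟩⟩, ⟨rfl, fun _ => rfl⟩, Relation.ReflTransGen.refl⟩
    · refine Finset.mem_erase.2 ⟨?_, hM.2.1 i j hij (Finset.mem_of_mem_erase h)⟩
      intro he
      simp only [Prod.mk.injEq] at he
      obtain ⟨rfl, rfl⟩ := he
      exact (hf 0).2.1 (Finset.mem_of_mem_erase h)
    · refine Finset.mem_erase.2 ⟨?_, hM.2.2 i j hi (Finset.mem_of_mem_erase h)⟩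
      intro he
      simp only [Prod.mk.injEq] at he
      obtain ⟨rfl, rfl⟩ := he
      have h' := Finset.mem_of_mem_erase h
      exact (hf 0).2.2 (hM.1 _ _ h').2 h'
  | @tail D1 D2 _ hs ih =>
    rintro ⟨p, q⟩ hlt hc hf
    simp only at hlt
    rcases hs with ⟨i, j, h1, h2, h3, h4, h5, h6, h7, h8, rfl⟩ |
        ⟨i, h2, h3, h4, h5, h6, h7, h8, h9, h10, h11, h12, rfl⟩
    · have sub : ∀ x, x ∈ D1 → x ≠ (i, j) → x ∈ insert (i + 1, j + 1) (D1.erase (i, j)) :=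
        fun x hx hne => Finset.mem_insert_of_mem (Finset.mem_erase.2 ⟨hne, hx⟩)
      rcases Finset.mem_insert.1 hc with he | hc1
      · simp only [Prod.mk.injEq] at he
        obtain ⟨rfl, rfl⟩ := he
        obtain ⟨b, hb, hsb, hch⟩ := ih (i, j) (by simpa using by omega) h2 (by
          intro s
          refine ⟨?_, ?_, ?_⟩
          · rcases s with _ | s
            · exact h8
            · intro hm
              refine (hf s).1 (sub _ ?_ ?_)
              · convert hm using 2 <;> omega
              · simp; omega
          · rcases s with _ | s
            · exact h6
            · intro hm
              refine (hf s).2.1 (sub _ ?_ ?_)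
              · convert hm using 2 <;> omega
              · simp; omega
          · intro _
            rcases s with _ | s
            · exact h4
            · intro hm
              refine (hf s).2.2 (by simpa using by omega) (sub _ ?_ ?_)
              · convert hm using 2 <;> omega
              · simp; omega)
        refine ⟨b, hb, ⟨?_, ?_⟩, ?_⟩
        · have := hsb.1
          simp only at this ⊢
          omega
        · intro h
          simp only at h
          omega
        · rwa [Finset.erase_insert]
          intro h
          exact h8 (Finset.mem_of_mem_erase h)
      · have hne := (Finset.mem_erase.1 hc1).1
        have hcD := (Finset.mem_erase.1 hc1).2
        have hfr : Free D1 (p, q) := by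
          intro s
          refine ⟨?_, ?_, ?_⟩
          · intro hm
            by_cases he : (p + s + 1, q + s + 1) = (i, j)
            · simp only [Prod.mk.injEq] at he
              obtain ⟨rfl, rfl⟩ := he
              refine (hf (s + 1)).1 (Finset.mem_insert.2 (Or.inl ?_))
              simp only [Prod.mk.injEq]; omega
            · exact (hf s).1 (sub _ hm he)
          · intro hm
            by_cases he : (p + s, q + s + 1) = (i, j)
            · simp only [Prod.mk.injEq] at he
              obtain ⟨rfl, rfl⟩ := he
              refine (hf (s + 1)).2.1 (Finset.mem_insert.2 (Or.inl ?_))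
              simp only [Prod.mk.injEq]; omega
            · exact (hf s).2.1 (sub _ hm he)
          · intro hpq hm
            by_cases he : (p + s + 1, q + s) = (i, j)
            · simp only [Prod.mk.injEq] at he
              obtain ⟨rfl, rfl⟩ := he
              refine (hf (s + 1)).2.2 hpq (Finset.mem_insert.2 (Or.inl ?_))
              simp only [Prod.mk.injEq]; omega
            · exact (hf s).2.2 hpq (sub _ hm he)
        obtain ⟨b, hb, hsb, hch⟩ := ih (p, q) hlt hcD hfr
        refine ⟨b, hb, hsb, hch.tail (Or.inl ⟨i, j, h1, Finset.mem_erase.2 ⟨Ne.symm hne, h2⟩, h3,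
          fun h => h4 (Finset.mem_of_mem_erase h), h5, fun h => h6 (Finset.mem_of_mem_erase h),
          h7, fun h => h8 (Finset.mem_of_mem_erase h), ?_⟩)⟩
        rw [Finset.erase_insert_of_ne, Finset.erase_right_comm]
        rintro he
        rw [he] at h8
        exact h8 hcD
    · have sub : ∀ x, x ∈ D1 → x ≠ (i, i + 1) →
          x ∈ insert (i + 2, i + 3) (D1.erase (i, i + 1)) :=
        fun x hx hne => Finset.mem_insert_of_mem (Finset.mem_erase.2 ⟨hne, hx⟩)
      rcases Finset.mem_insert.1 hc with he | hc1
      · simp only [Prod.mk.injEq] at he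
        obtain ⟨rfl, rfl⟩ := he
        obtain ⟨b, hb, hsb, hch⟩ := ih (i, i + 1) (by simp) h2 (by
          intro s
          refine ⟨?_, ?_, ?_⟩
          · rcases s with _ | _ | s
            · exact h8
            · exact h12
            · intro hm
              refine (hf s).1 (sub _ ?_ ?_)
              · convert hm using 2 <;> omega
              · simp; omega
          · rcases s with _ | _ | s
            · exact h4
            · exact h10
            · intro hm
              refine (hf s).2.1 (sub _ ?_ ?_)
              · convert hm using 2 <;> omega
              · simp; omega
          · intro h
            simp at h)
        refine ⟨b, hb, ⟨?_, ?_⟩, ?_⟩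
        · have := hsb.1
          simp only at this ⊢
          omega
        · intro h
          have := hsb.2 rfl
          simp only at this ⊢
          omega
        · rwa [Finset.erase_insert]
          intro h
          exact h12 (Finset.mem_of_mem_erase h)
      · have hne := (Finset.mem_erase.1 hc1).1
        have hcD := (Finset.mem_erase.1 hc1).2
        have hfr : Free D1 (p, q) := by
          intro s
          refine ⟨?_, ?_, ?_⟩
          · intro hm
            by_cases he : (p + s + 1, q + s + 1) = (i, i + 1)
            · simp only [Prod.mk.injEq] at he
              refine (hf (s + 2)).1 (Finset.mem_insert.2 (Or.inl ?_))
              simp only [Prod.mk.injEq]; omega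
            · exact (hf s).1 (sub _ hm he)
          · intro hm
            by_cases he : (p + s, q + s + 1) = (i, i + 1)
            · simp only [Prod.mk.injEq] at he
              refine (hf (s + 2)).2.1 (Finset.mem_insert.2 (Or.inl ?_))
              simp only [Prod.mk.injEq]; omega
            · exact (hf s).2.1 (sub _ hm he)
          · intro hpq hm
            by_cases he : (p + s + 1, q + s) = (i, i + 1)
            · simp only [Prod.mk.injEq] at he
              refine (hf (s + 2)).2.2 hpq (Finset.mem_insert.2 (Or.inl ?_))
              simp only [Prod.mk.injEq]; omega
            · exact (hf s).2.2 hpq (sub _ hm he)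
        obtain ⟨b, hb, hsb, hch⟩ := ih (p, q) hlt hcD hfr
        refine ⟨b, hb, hsb, hch.tail (Or.inr ⟨i, Finset.mem_erase.2 ⟨Ne.symm hne, h2⟩, h3,
          fun h => h4 (Finset.mem_of_mem_erase h), h5, fun h => h6 (Finset.mem_of_mem_erase h),
          h7, fun h => h8 (Finset.mem_of_mem_erase h),
          h9, fun h => h10 (Finset.mem_of_mem_erase h),
          h11, fun h => h12 (Finset.mem_of_mem_erase h), ?_⟩)⟩
        rw [Finset.erase_insert_of_ne, Finset.erase_right_comm]
        rintro he
        rw [he] at h12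
        exact h12 hcD

theorem Remb.unique {M : Finset (ℕ × ℕ)} (hM : Idl M) {a b c : ℕ × ℕ} (ha : Remb M a)
    (hb : Remb M b) (sa : Same a c) (sb : Same b c) : a = b := by
  have aux : ∀ i j i' j', Remb M (i, j) → Remb M (i', j') → j + i' = j' + i → ¬ i < i' := by
    intro i j i' j' h1 h2 h3 h4
    have := hM.1 _ _ h1.1
    exact h1.right hM (hM.down h2.1 this.1 (by omega) (by omega) (by omega))
  obtain ⟨i, j⟩ := a
  obtain ⟨i', j'⟩ := b
  have e1 := sa.1
  have e2 := sb.1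
  simp only at e1 e2
  have h1 := aux _ _ _ _ ha hb (by omega)
  have h2 := aux _ _ _ _ hb ha (by omega)
  simp only [Prod.mk.injEq]
  omega

noncomputable def GG (L : Finset (ℕ × ℕ)) (X : ℕ → ℚ) (M : Finset (ℕ × ℕ)) : ℚ :=
  ∑ D ∈ EE L M, ∏ p ∈ D, (X p.1 + X p.2)

theorem GG_zero {L M : Finset (ℕ × ℕ)} {X : ℕ → ℚ} (hL : Idl L) (hM : Idl M) (h : ¬ M ⊆ L) :
    GG L X M = 0 := by
  rw [GG, EE_empty hL hM h, Finset.sum_empty]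

theorem GG_congr {L M : Finset (ℕ × ℕ)} {X Y : ℕ → ℚ} (hL : Idl L)
    (h : ∀ k, 1 ≤ k → X k = Y k) : GG L X M = GG L Y M := by
  unfold GG
  refine Finset.sum_congr rfl fun D hD => Finset.prod_congr rfl fun p hp => ?_
  have := hL.1 p.1 p.2 ((mem_EE.1 hD).1 hp)
  rw [h _ this.1, h _ (by omega)]

theorem GG_rec {L M : Finset (ℕ × ℕ)} {X : ℕ → ℚ} (hL : Idl L) (hM : Idl M) (hML : M ⊆ L)
    {c : ℕ × ℕ} (hc : Remb L c) :
    GG L X M = GG (L.erase c) X M +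
      (X c.1 + X c.2) * ∑ b ∈ M.filter (fun b => Remb M b ∧ Same b c),
        GG (L.erase c) X (M.erase b) := by
  have e1 : (EE L M).filter (fun D => c ∉ D) = EE (L.erase c) M := by
    ext D
    simp only [Finset.mem_filter, mem_EE]
    constructor
    · rintro ⟨⟨h1, h2⟩, h3⟩
      exact ⟨fun x hx => Finset.mem_erase.2 ⟨fun h => h3 (h ▸ hx), h1 hx⟩,
        chain_restrict hL hc h2 h3⟩
    · rintro ⟨h1, h2⟩
      refine ⟨⟨h1.trans (Finset.erase_subset _ _),
        chain_mono (Finset.erase_subset _ _) h2⟩, ?_⟩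
      intro h
      simpa using h1 h
  have e2 : ∀ D, D ∈ EE L M → c ∈ D → ∃ b, Remb M b ∧ Same b c ∧
      D.erase c ∈ EE (L.erase c) (M.erase b) := by
    intro D hD hcD
    rw [mem_EE] at hD
    have hf : Free D c := by
      obtain ⟨p, q⟩ := c
      have hh := hL.1 _ _ hc.1
      intro s
      refine ⟨fun h => ?_, fun h => ?_, fun hpq h => ?_⟩
      · exact hc.right hL (hL.down (hD.1 h) hh.1 (by simp only; omega) (by omega)
          (by simp only; omega))
      · exact hc.right hL (hL.down (hD.1 h) hh.1 (by simp only; omega) (by omega)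
          (by simp only; omega))
      · exact hc.below hL (hL.down (hD.1 h) (by omega) (by simp only; omega) hpq
          (by simp only; omega))
    obtain ⟨b, hb, hs, hch⟩ := chain_free hM hD.2 c (hL.1 c.1 c.2 hc.1).2 hcD hf
    refine ⟨b, hb, hs, mem_EE.2 ⟨Finset.erase_subset_erase _ hD.1,
      chain_restrict hL hc hch (by simp)⟩⟩
  have split : GG L X M = ∑ D ∈ (EE L M).filter (fun D => c ∉ D), ∏ p ∈ D, (X p.1 + X p.2) +
      ∑ D ∈ (EE L M).filter (fun D => c ∈ D), ∏ p ∈ D, (X p.1 + X p.2) := by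
    rw [GG, add_comm, ← Finset.sum_filter_add_sum_filter_not (EE L M) (fun D => c ∈ D)]
  rw [split, e1]
  congr 1
  by_cases hex : ∃ b, Remb M b ∧ Same b c
  · obtain ⟨b, hb, hs⟩ := hex
    have hfil : M.filter (fun b => Remb M b ∧ Same b c) = {b} := by
      ext x
      simp only [Finset.mem_filter, Finset.mem_singleton]
      constructor
      · rintro ⟨_, h1, h2⟩
        exact h1.unique hM hb h2 hs
      · rintro rfl
        exact ⟨hb.1, hb, hs⟩
    rw [hfil, Finset.sum_singleton, GG, Finset.mul_sum]
    have him : (EE L M).filter (fun D => c ∈ D) =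
        (EE (L.erase c) (M.erase b)).image (fun D => insert c D) := by
      ext D
      simp only [Finset.mem_filter, Finset.mem_image]
      constructor
      · rintro ⟨h1, h2⟩
        obtain ⟨b', hb', hs', hm⟩ := e2 D h1 h2
        obtain rfl := hb'.unique hM hb hs' hs
        exact ⟨_, hm, Finset.insert_erase h2⟩
      · rintro ⟨D', h1, rfl⟩
        rw [mem_EE] at h1
        refine ⟨mem_EE.2 ⟨?_, ?_⟩, Finset.mem_insert_self _ _⟩
        · exact Finset.insert_subset hc.1 (h1.1.trans (Finset.erase_subset _ _))
        · exact (chain_slide hL hM hML hc hb hs).trans (chain_insert hL hc h1.2)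
    have nc : ∀ D ∈ EE (L.erase c) (M.erase b), c ∉ D := by
      intro D hD h
      simpa using (mem_EE.1 hD).1 h
    rw [him, Finset.sum_image]
    · refine Finset.sum_congr rfl fun D hD => ?_
      rw [Finset.prod_insert (nc D hD)]
    · intro D hD D' hD' he
      simp only at he
      rw [← Finset.erase_insert (nc D hD), he, Finset.erase_insert (nc D' hD')]
  · have hfil : M.filter (fun b => Remb M b ∧ Same b c) = ∅ := by
      rw [Finset.filter_eq_empty_iff]
      intro x _ h
      exact hex ⟨x, h⟩
    have him : (EE L M).filter (fun D => c ∈ D) = ∅ := by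
      rw [Finset.filter_eq_empty_iff]
      intro D hD hcD
      obtain ⟨b, h1, h2, _⟩ := e2 D hD hcD
      exact hex ⟨b, h1, h2⟩
    rw [hfil, him]
    simp


theorem seg {S : Finset ℕ} {k : ℕ} (h1 : ∀ x ∈ S, k < x) (h2 : ∀ x, k < x → x + 1 ∈ S → x ∈ S)
    (x : ℕ) : x ∈ S ↔ k < x ∧ x ≤ k + S.card := by
  have a : ∀ s x, k < x → x + s ∈ S → x ∈ S := by
    intro s
    induction s with
    | zero => intro x _ h; exact h
    | succ s ih => intro x hx h; exact ih x hx (h2 _ (by omega) h)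
  have b : ∀ x ∈ S, Finset.Ioc k x ⊆ S := by
    intro x hx y hy
    rw [Finset.mem_Ioc] at hy
    exact a (x - y) y hy.1 (by rwa [show y + (x - y) = x by omega])
  have c : S ⊆ Finset.Ioc k (k + S.card) := by
    intro x hx
    have := Finset.card_le_card (b x hx)
    rw [Nat.card_Ioc] at this
    rw [Finset.mem_Ioc]
    exact ⟨h1 x hx, by omega⟩
  have e := Finset.eq_of_subset_of_card_le c (by rw [Nat.card_Ioc]; omega)
  constructor
  · intro h
    exact Finset.mem_Ioc.1 (c h)
  · intro h
    rw [e]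
    exact Finset.mem_Ioc.2 h

noncomputable def rowS (L : Finset (ℕ × ℕ)) (k : ℕ) : Finset ℕ :=
  (L.filter (fun p => p.1 = k)).image Prod.snd
noncomputable def colS (L : Finset (ℕ × ℕ)) (k : ℕ) : Finset ℕ :=
  (L.filter (fun p => p.2 = k)).image Prod.fst
noncomputable def diaS (L : Finset (ℕ × ℕ)) (d : ℕ) : Finset ℕ :=
  (L.filter (fun p => p.2 = p.1 + d)).image Prod.fst

theorem mem_rowS {L : Finset (ℕ × ℕ)} {k j : ℕ} : j ∈ rowS L k ↔ (k, j) ∈ L := by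
  simp only [rowS, Finset.mem_image, Finset.mem_filter, Prod.exists]
  constructor
  · rintro ⟨a, b, ⟨h, rfl⟩, rfl⟩; exact h
  · intro h; exact ⟨k, j, ⟨h, rfl⟩, rfl⟩

theorem mem_colS {L : Finset (ℕ × ℕ)} {k i : ℕ} : i ∈ colS L k ↔ (i, k) ∈ L := by
  simp only [colS, Finset.mem_image, Finset.mem_filter, Prod.exists]
  constructor
  · rintro ⟨a, b, ⟨h, rfl⟩, rfl⟩; exact h
  · intro h; exact ⟨i, k, ⟨h, rfl⟩, rfl⟩

theorem mem_diaS {L : Finset (ℕ × ℕ)} {d i : ℕ} : i ∈ diaS L d ↔ (i, i + d) ∈ L := by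
  simp only [diaS, Finset.mem_image, Finset.mem_filter, Prod.exists]
  constructor
  · rintro ⟨a, b, ⟨h, rfl⟩, rfl⟩; exact h
  · intro h; exact ⟨i, i + d, ⟨h, rfl⟩, rfl⟩

theorem Idl.row {L : Finset (ℕ × ℕ)} (h : Idl L) (k j : ℕ) :
    (k, j) ∈ L ↔ k < j ∧ j ≤ k + (rowS L k).card := by
  rw [← mem_rowS]
  refine seg (fun x hx => (h.1 _ _ (mem_rowS.1 hx)).2) (fun x hx hm => ?_) j
  exact mem_rowS.2 (h.2.1 _ _ hx (mem_rowS.1 hm))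

theorem Idl.col {L : Finset (ℕ × ℕ)} (h : Idl L) (i k : ℕ) :
    (i, k) ∈ L ↔ 0 < i ∧ i ≤ (colS L k).card := by
  rw [← mem_colS]
  have := seg (S := colS L k) (k := 0) (fun x hx => (h.1 _ _ (mem_colS.1 hx)).1)
    (fun x hx hm => mem_colS.2 (h.2.2 _ _ hx (mem_colS.1 hm))) i
  rwa [zero_add] at this

theorem Idl.dia {L : Finset (ℕ × ℕ)} (h : Idl L) {d : ℕ} (hd : 1 ≤ d) (i : ℕ) :
    (i, i + d) ∈ L ↔ 0 < i ∧ i ≤ (diaS L d).card := by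
  rw [← mem_diaS]
  have := seg (S := diaS L d) (k := 0) (fun x hx => (h.1 _ _ (mem_diaS.1 hx)).1)
    (fun x hx hm => mem_diaS.2 (h.down (mem_diaS.1 hm) hx (by omega) (by omega) (by omega))) i
  rwa [zero_add] at this

theorem Idl.col_le {L : Finset (ℕ × ℕ)} (h : Idl L) {k : ℕ} (hk : 1 ≤ k) :
    (colS L k).card ≤ k - 1 := by
  by_contra hlt
  have := (h.col k k).2 ⟨by omega, by omega⟩
  have := h.1 _ _ this
  omega

theorem Idl.col_full {L : Finset (ℕ × ℕ)} (h : Idl L) {k : ℕ} (hk : 1 ≤ k)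
    (hr : 0 < (rowS L k).card) : (colS L k).card = k - 1 := by
  apply le_antisymm (h.col_le hk)
  by_cases h1 : k = 1
  · omega
  have a := (h.row k (k + 1)).2 ⟨by omega, by omega⟩
  have b := h.down (i := k - 1) (j := k) a (by omega) (by omega) (by omega) (by omega)
  exact ((h.col _ _).1 b).2

noncomputable def nn (L : Finset (ℕ × ℕ)) (k : ℕ) : ℤ :=
  ((rowS L k).card : ℤ) + ((colS L k).card : ℤ) + 1 - k

noncomputable def XX (L : Finset (ℕ × ℕ)) (t : ℕ → ℚ) (k : ℕ) : ℚ :=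
  if 0 < nn L k then t (nn L k).toNat
  else if nn L k < 0 then - t (- nn L k).toNat
  else (-1) ^ k * t 0

noncomputable def tref (c : ℕ × ℕ) (t : ℕ → ℚ) (n : ℕ) : ℚ :=
  if c.2 = c.1 + 1 then
    (if n = 0 then (-1) ^ c.1 * t 1 else if n = 1 then (-1) ^ c.1 * t 0 else t n)
  else
    (if n = c.2 - c.1 then t (c.2 - c.1 - 1) else if n = c.2 - c.1 - 1 then t (c.2 - c.1) else t n)

theorem rowS_erase {L : Finset (ℕ × ℕ)} {p q k : ℕ} (h : k ≠ p) :
    rowS (L.erase (p, q)) k = rowS L k := by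
  ext j
  simp [mem_rowS, h]

theorem colS_erase {L : Finset (ℕ × ℕ)} {p q k : ℕ} (h : k ≠ q) :
    colS (L.erase (p, q)) k = colS L k := by
  ext j
  simp [mem_colS, h]

theorem corner_counts {L : Finset (ℕ × ℕ)} (hL : Idl L) {p q : ℕ} (hc : Remb L (p, q)) :
    1 ≤ p ∧ p < q ∧ nn L p = (q : ℤ) - p ∧ nn L q = (p : ℤ) + 1 - q ∧
    nn (L.erase (p, q)) p = (q : ℤ) - p - 1 ∧ nn (L.erase (p, q)) q = (p : ℤ) - q := by
  obtain ⟨h1, h2⟩ := hL.1 _ _ hc.1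
  have r := hc.right hL
  have b := hc.below hL
  have a1 := (hL.row p q).1 hc.1
  have a2 := mt (hL.row p (q + 1)).2 r
  have a3 := (hL.col p q).1 hc.1
  have a4 := mt (hL.col (p + 1) q).2 b
  have a5 := hL.col_full h1 (by omega)
  have a6 : (rowS L q).card = 0 := by
    by_contra hne
    have := (hL.row q (q + 1)).2 ⟨by omega, by omega⟩
    exact r (hL.down this h1 (by omega) (by omega) le_rfl)
  have e1 : (rowS (L.erase (p, q)) p).card = (rowS L p).card - 1 := by
    have : rowS (L.erase (p, q)) p = (rowS L p).erase q := by
      ext j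
      simp [mem_rowS]
    rw [this, Finset.card_erase_of_mem (mem_rowS.2 hc.1)]
  have e2 : (colS (L.erase (p, q)) q).card = (colS L q).card - 1 := by
    have : colS (L.erase (p, q)) q = (colS L q).erase p := by
      ext j
      simp [mem_colS]
    rw [this, Finset.card_erase_of_mem (mem_colS.2 hc.1)]
  have e3 : rowS (L.erase (p, q)) q = rowS L q := rowS_erase (by omega)
  have e4 : colS (L.erase (p, q)) p = colS L p := colS_erase (by omega)
  refine ⟨h1, h2, ?_, ?_, ?_, ?_⟩ <;> unfold nn <;> (try rw [e1]) <;> (try rw [e2]) <;>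
    (try rw [e3]) <;> (try rw [e4]) <;> omega

theorem other_counts {L : Finset (ℕ × ℕ)} (hL : Idl L) {p q : ℕ} (hc : Remb L (p, q)) {k : ℕ}
    (hk : 1 ≤ k) (hp : k ≠ p) (hq : k ≠ q) :
    |nn L k| < (q : ℤ) - p - 1 ∨ (q : ℤ) - p < |nn L k| := by
  obtain ⟨h1, h2⟩ := hL.1 _ _ hc.1
  have r := hc.right hL
  have b := hc.below hL
  have cl := hL.col_le hk
  unfold nn
  rcases Nat.lt_or_ge k p with hkp | hkp
  · have a1 := (hL.row k q).1 (hL.down hc.1 hk (by omega) (by omega) le_rfl)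
    have a2 := hL.col_full hk (by omega)
    right
    rw [abs_of_nonneg (by omega)]
    omega
  · rcases Nat.eq_zero_or_pos (rowS L k).card with h0 | h0
    · rcases Nat.lt_or_ge k q with hkq | hkq
      · have a1 := (hL.col p k).1 (hL.down hc.1 h1 le_rfl (by omega) (by omega))
        left
        rw [abs_of_nonpos (by omega)]
        omega
      · have a1 : ¬ p ≤ (colS L k).card := by
          intro h
          exact r (hL.down ((hL.col p k).2 ⟨h1, h⟩) h1 le_rfl (by omega) (by omega))
        right
        rw [abs_of_nonpos (by omega)]
        omega
    · have a2 := hL.col_full hk h0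
      have a3 := (hL.row k (k + (rowS L k).card)).2 ⟨by omega, le_rfl⟩
      have a4 : k + (rowS L k).card < q := by
        by_contra hge
        rcases Nat.lt_or_ge q (k + (rowS L k).card) with h | h
        · exact r (hL.down a3 h1 (by omega) (by omega) h)
        · exact b (hL.down a3 (by omega) (by omega) (by omega) (by omega))
      left
      rw [abs_of_nonneg (by omega)]
      omega

theorem XX_ref {L : Finset (ℕ × ℕ)} (hL : Idl L) {c : ℕ × ℕ} (hc : Remb L c) (t : ℕ → ℚ) (k : ℕ)
    (hk : 1 ≤ k) : XX L t k = XX (L.erase c) (tref c t) k := by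
  obtain ⟨p, q⟩ := c
  obtain ⟨h1, h2, n1, n2, n3, n4⟩ := corner_counts hL hc
  by_cases hp : k = p
  · subst hp
    unfold XX
    rw [n1, n3, if_pos (by omega)]
    by_cases hd : q = k + 1
    · subst hd
      simp [tref, ← mul_assoc, ← pow_add, ← two_mul]
    · rw [if_pos (by omega)]
      simp only [tref]
      rw [if_neg hd, if_neg (by omega), if_pos (by omega)]
      congr 1
      omega
  by_cases hq : k = q
  · subst hq
    unfold XX
    rw [n2, n4, if_neg (show ¬ (0 : ℤ) < (p : ℤ) + 1 - k by omega),
      if_neg (show ¬ (0 : ℤ) < (p : ℤ) - k by omega), if_pos (show (p : ℤ) - k < 0 by omega)]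
    by_cases hd : k = p + 1
    · subst hd
      simp [tref, pow_succ]
    · rw [if_pos (show (p : ℤ) + 1 - k < 0 by omega)]
      simp only [tref]
      rw [if_neg hd, if_pos (by omega)]
      congr 2
      omega
  · have hn : nn (L.erase (p, q)) k = nn L k := by
      unfold nn
      rw [rowS_erase hp, colS_erase hq]
    have ho := other_counts hL hc hk hp hq
    have hz : nn L k ≠ 0 ∨ 2 ≤ (q : ℤ) - p - 1 + 1 := by
      rcases ho with ho | ho
      · right
        have := abs_nonneg (nn L k)
        omega
      · left
        intro h
        rw [h] at ho
        simp at ho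
        omega
    unfold XX
    rw [hn]
    rcases lt_trichotomy (nn L k) 0 with h | h | h
    · rw [abs_of_neg h] at ho
      rw [if_neg (by omega), if_pos h, if_neg (by omega), if_pos h]
      simp only [tref]
      split_ifs <;> first | rfl | omega
    · rw [h] at ho
      simp only [abs_zero] at ho
      rw [h]
      simp only [lt_irrefl, if_false, tref]
      split_ifs <;> first | rfl | omega
    · rw [abs_of_pos h] at ho
      rw [if_pos h, if_pos h]
      simp only [tref]
      split_ifs <;> first | rfl | omega

noncomputable def zz (t : ℕ → ℚ) (p : ℕ × ℕ) : ℚ :=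
  if p.2 = p.1 + 1 then t 1 + (-1) ^ p.2 * t 0 else t (p.2 - p.1) - t (p.2 - p.1 - 1)

noncomputable def wt (t : ℕ → ℚ) (M : Finset (ℕ × ℕ)) : ℚ := ∑ p ∈ M, zz t p

theorem XX_corner {L : Finset (ℕ × ℕ)} (hL : Idl L) {c : ℕ × ℕ} (hc : Remb L c) (t : ℕ → ℚ) :
    XX L t c.1 + XX L t c.2 = zz t c := by
  obtain ⟨p, q⟩ := c
  obtain ⟨h1, h2, n1, n2, -, -⟩ := corner_counts hL hc
  simp only [XX, n1, n2, zz]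
  rw [if_pos (by omega), if_neg (by omega)]
  by_cases hd : q = p + 1
  · subst hd
    simp
  · rw [if_pos (by omega), if_neg hd]
    rw [show ((q : ℤ) - p).toNat = q - p by omega,
      show (-((p : ℤ) + 1 - q)).toNat = q - p - 1 by omega, sub_eq_add_neg]

def Adj (u c : ℕ × ℕ) : Prop := u.2 + c.1 = c.2 + u.1 + 1 ∨ u.2 + c.1 + 1 = c.2 + u.1

theorem zz_ref {u c : ℕ × ℕ} (hu : u.1 < u.2) (hc : c.1 < c.2) (t : ℕ → ℚ) :
    zz (tref c t) u = zz t u + zz t c *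
      ((if Adj u c then 1 else 0) - 2 * (if Same u c then 1 else 0)) := by
  obtain ⟨i, j⟩ := u
  obtain ⟨p, q⟩ := c
  change i < j at hu
  change p < q at hc
  obtain ⟨d, rfl⟩ := Nat.exists_eq_add_of_lt hu
  obtain ⟨e, rfl⟩ := Nat.exists_eq_add_of_lt hc
  simp only [zz, tref, Same, Adj]
  have s1 : i + d + 1 - i = d + 1 := by omega
  have s2 : p + e + 1 - p = e + 1 := by omega
  have s3 : (i + d + 1 = i + 1) = (d = 0) := by simp
  have s4 : (p + e + 1 = p + 1) = (e = 0) := by simp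
  have s5 : (i + d + 1 + p = p + e + 1 + i) = (d = e) := by
    apply propext; constructor <;> intro h <;> omega
  have s6 : (i + d + 1 + p = p + e + 1 + i + 1) = (d = e + 1) := by
    apply propext; constructor <;> intro h <;> omega
  have s7 : (i + d + 1 + p + 1 = p + e + 1 + i) = (d + 1 = e) := by
    apply propext; constructor <;> intro h <;> omega
  simp only [s1, s2, s3, s4, s5, s6, s7, Nat.add_sub_cancel]
  by_cases he : e = 0
  · subst he
    by_cases hd : d = 0
    · subst hd
      rcases Nat.even_or_odd i with hi | hi <;> rcases Nat.even_or_odd p with hp | hp <;>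
        simp [pow_succ, hi.neg_one_pow, hp.neg_one_pow]
      · have : i % 2 = p % 2 := by rw [Nat.even_iff.1 hi, Nat.even_iff.1 hp]
        simp [this]; ring
      · have : ¬ i % 2 = p % 2 := by rw [Nat.even_iff.1 hi, Nat.odd_iff.1 hp]; simp
        simp [this]; ring
      · have : ¬ i % 2 = p % 2 := by rw [Nat.odd_iff.1 hi, Nat.even_iff.1 hp]; simp
        simp [this]; ring
      · have : i % 2 = p % 2 := by rw [Nat.odd_iff.1 hi, Nat.odd_iff.1 hp]
        simp [this]; ring
    · by_cases hd1 : d = 1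
      · subst hd1
        simp [pow_succ]; ring
      · simp [hd, hd1]
  · obtain ⟨e, rfl⟩ := Nat.exists_eq_succ_of_ne_zero he
    by_cases hd : d = 0
    · subst hd
      by_cases he0 : e = 0
      · subst he0
        simp; ring
      · have : ¬ (0 = e) := fun h => he0 h.symm
        simp [he0]
    · obtain ⟨d, rfl⟩ := Nat.exists_eq_succ_of_ne_zero hd
      simp only [Nat.succ_eq_add_one]
      by_cases h1 : d = e
      · subst h1; simp; ring
      by_cases h2 : d = e + 1
      · subst h2; simp; intro h; omega
      by_cases h3 : d + 1 = e
      · subst h3; simp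
      have h4 : ¬ d + 1 + 1 = e + 1 := by omega
      have h5 : ¬ d + 1 + 1 = e + 1 + 1 := by omega
      have h6 : ¬ d + 1 = e + 1 + 1 := by omega
      simp [h1, h2, h3]


theorem dia_card (M : Finset (ℕ × ℕ)) (d : ℕ) :
    (M.filter (fun p => p.2 = p.1 + d)).card = (diaS M d).card := by
  unfold diaS
  rw [Finset.card_image_of_injOn]
  intro x hx y hy hxy
  simp only [Finset.coe_filter, Set.mem_ofPred_eq] at hx hy
  try simp only at hxy
  exact Prod.ext hxy (by omega)

theorem wt_ref {M : Finset (ℕ × ℕ)} (hM : Idl M) {c : ℕ × ℕ} (hc : c.1 < c.2) (t : ℕ → ℚ) :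
    wt (tref c t) M = wt t M + zz t c *
      (((M.filter (fun u => Adj u c)).card : ℚ) - 2 * ((M.filter (fun u => Same u c)).card : ℚ)) := by
  unfold wt
  rw [Finset.sum_congr rfl (fun u hu => zz_ref (u := u) (c := c) (hM.1 u.1 u.2 hu).2 hc t)]
  rw [Finset.sum_add_distrib, ← Finset.mul_sum, Finset.sum_sub_distrib, ← Finset.mul_sum,
    Finset.sum_boole, Finset.sum_boole]

theorem dia_zero {M : Finset (ℕ × ℕ)} (hM : Idl M) : (diaS M 0).card = 0 := by
  rw [Finset.card_eq_zero, Finset.eq_empty_iff_forall_notMem]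
  intro i hi
  have := hM.1 _ _ (mem_diaS.1 hi)
  omega

theorem card_adj {M : Finset (ℕ × ℕ)} (p d : ℕ) (hd : 1 ≤ d) :
    (M.filter (fun u => Adj u (p, p + d))).card = (diaS M (d + 1)).card + (diaS M (d - 1)).card := by
  rw [← dia_card, ← dia_card, ← Finset.card_union_of_disjoint]
  · congr 1
    ext u
    rw [Finset.mem_filter, Finset.mem_union, Finset.mem_filter, Finset.mem_filter]; unfold Adj
    constructor
    · rintro ⟨h, h1 | h1⟩
      · left; exact ⟨h, by omega⟩
      · right; exact ⟨h, by omega⟩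
    · rintro (⟨h, h1⟩ | ⟨h, h1⟩)
      · exact ⟨h, by omega⟩
      · exact ⟨h, by omega⟩
  · rw [Finset.disjoint_left]
    intro u h1 h2
    simp only [Finset.mem_filter] at h1 h2
    omega

theorem card_same2 {M : Finset (ℕ × ℕ)} (p d : ℕ) (hd : 2 ≤ d) :
    (M.filter (fun u => Same u (p, p + d))).card = (diaS M d).card := by
  rw [← dia_card]
  congr 1
  ext u
  rw [Finset.mem_filter, Finset.mem_filter]; unfold Same
  constructor
  · rintro ⟨h, h1, -⟩
    exact ⟨h, by omega⟩
  · rintro ⟨h, h1⟩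
    exact ⟨h, by omega, fun h => by omega⟩

theorem cnt (r n : ℕ) (hr : r < 2) : ((Finset.Ioc 0 n).filter (fun i => i % 2 = r)).card = (n + r) / 2 := by
  induction n with
  | zero => simp; omega
  | succ n ih =>
    rw [show Finset.Ioc 0 (n + 1) = insert (n + 1) (Finset.Ioc 0 n) by ext; simp only [Finset.mem_insert, Finset.mem_Ioc]; omega, Finset.filter_insert]
    split_ifs with h
    · rw [Finset.card_insert_of_notMem (by simp), ih]
      omega
    · rw [ih]
      omega

theorem card_same1 {M : Finset (ℕ × ℕ)} (hM : Idl M) (p : ℕ) :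
    (M.filter (fun u => Same u (p, p + 1))).card = ((diaS M 1).card + p % 2) / 2 := by
  rw [← cnt _ _ (Nat.mod_lt _ (by norm_num))]
  rw [← Finset.card_image_of_injOn (s := M.filter (fun u => Same u (p, p + 1))) (f := Prod.fst)]
  · congr 1
    ext i
    simp only [Finset.mem_image, Finset.mem_filter, Prod.exists, Finset.mem_Ioc]
    rw [← hM.dia le_rfl]
    constructor
    · rintro ⟨a, b, ⟨h1, h2, h3⟩, rfl⟩
      simp only at h2 h3
      have : b = a + 1 := by omega
      subst this
      exact ⟨h1, h3 trivial⟩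
    · rintro ⟨h1, h2⟩
      exact ⟨i, i + 1, ⟨h1, by simp only; omega, fun _ => h2⟩, rfl⟩
  · intro x hx y hy hxy
    simp only [Finset.coe_filter, Set.mem_ofPred_eq, Same] at hx hy
    try simp only at hxy
    exact Prod.ext hxy (by omega)

theorem interl {M : Finset (ℕ × ℕ)} (hM : Idl M) {d : ℕ} (hd : 1 ≤ d) :
    (diaS M (d + 1)).card ≤ (diaS M d).card ∧ (diaS M d).card ≤ (diaS M (d + 1)).card + 1 := by
  constructor
  · by_contra h
    have a := (hM.dia (d := d + 1) (by omega) (diaS M (d + 1)).card).2 ⟨by omega, le_rfl⟩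
    have b := hM.down (i := (diaS M (d + 1)).card) (j := (diaS M (d + 1)).card + d) a (by omega)
      le_rfl (by omega) (by omega)
    have := (hM.dia hd _).1 b
    omega
  · by_contra h
    have a := (hM.dia (d := d) hd (diaS M d).card).2 ⟨by omega, le_rfl⟩
    have b := hM.down (i := (diaS M d).card - 1) (j := (diaS M d).card - 1 + (d + 1)) a (by omega)
      (by omega) (by omega) (by omega)
    have := (hM.dia (by omega) _).1 b
    omega

theorem addEx {M : Finset (ℕ × ℕ)} (hM : Idl M) (p d : ℕ) (hd : 1 ≤ d) :
    (∃ a, Addb M a ∧ Same a (p, p + d)) ↔ (diaS M d).card ≤ (diaS M (d + 1)).card ∧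
      (d = 1 ∨ (diaS M d).card + 1 ≤ (diaS M (d - 1)).card) ∧
      (d = 1 → ((diaS M d).card + 1) % 2 = p % 2) := by
  constructor
  · rintro ⟨⟨i, j⟩, ⟨h1, h2⟩, h3, h4⟩
    simp only at h3 h4
    have : j = i + d := by omega
    subst this
    have hi := (h2.1 i (i + d) (Finset.mem_insert_self _ _)).1
    have k1 : ∀ x y, 1 ≤ x → x < y → x ≤ i → y ≤ i + d → (x, y) ≠ (i, i + d) → (x, y) ∈ M := by
      intro x y q1 q2 q3 q4 q5
      have := h2.down (Finset.mem_insert_self _ _) q1 q3 q2 q4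
      exact (Finset.mem_insert.1 this).resolve_left q5
    have k2 := mt (hM.dia hd i).2 h1
    have e : i = (diaS M d).card + 1 := by
      by_contra hne
      have := (hM.dia hd (i - 1)).1 (k1 _ _ (by omega) (by omega) (by omega) (by omega)
        (by simp; omega))
      omega
    refine ⟨?_, ?_, ?_⟩
    · by_contra hlt
      have := (hM.dia (d := d + 1) (by omega) (i - 1)).1 (k1 _ _ (by omega) (by omega) (by omega)
        (by omega) (by simp; omega))
      omega
    · by_cases h : d = 1
      · exact Or.inl h
      · right
        have := (hM.dia (d := d - 1) (by omega) i).1 (k1 _ _ (by omega) (by omega) (by omega)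
          (by omega) (by simp; omega))
        omega
    · intro h
      have := h4 (by omega)
      rw [← e, this]
  · rintro ⟨h1, h2, h3⟩
    refine ⟨((diaS M d).card + 1, (diaS M d).card + 1 + d), ⟨?_, ?_, ?_, ?_⟩, ?_, ?_⟩
    · intro h
      have := (hM.dia hd _).1 h
      omega
    · intro i j h
      rcases Finset.mem_insert.1 h with h | h
      · rw [Prod.mk.injEq] at h
        omega
      · exact hM.1 i j h
    · intro i j hij h
      rcases Finset.mem_insert.1 h with h | h
      · rw [Prod.mk.injEq] at h
        apply Finset.mem_insert_of_mem
        have := (hM.dia (d := d - 1) (by omega) i).2 ⟨by omega, by omega⟩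
        rwa [show j = i + (d - 1) by omega]
      · exact Finset.mem_insert_of_mem (hM.2.1 i j hij h)
    · intro i j hij h
      rcases Finset.mem_insert.1 h with h | h
      · rw [Prod.mk.injEq] at h
        apply Finset.mem_insert_of_mem
        have := (hM.dia (d := d + 1) (by omega) i).2 ⟨by omega, by omega⟩
        rwa [show j = i + (d + 1) by omega]
      · exact Finset.mem_insert_of_mem (hM.2.2 i j hij h)
    · simp only; omega
    · simp only
      intro h
      exact h3 (by omega)

theorem remEx {M : Finset (ℕ × ℕ)} (hM : Idl M) (p d : ℕ) (hd : 1 ≤ d) :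
    (∃ b, Remb M b ∧ Same b (p, p + d)) ↔ 1 ≤ (diaS M d).card ∧
      (diaS M (d + 1)).card < (diaS M d).card ∧
      (d = 1 ∨ (diaS M (d - 1)).card ≤ (diaS M d).card) ∧
      (d = 1 → (diaS M d).card % 2 = p % 2) := by
  constructor
  · rintro ⟨⟨i, j⟩, h0, h3, h4⟩
    simp only at h3 h4
    have : j = i + d := by omega
    subst this
    have hr := h0.right hM
    have hb := h0.below hM
    have a := (hM.dia hd i).1 h0.1
    have b := mt (hM.dia (d := d + 1) (by omega) i).2 hr
    have := interl hM hd
    have e : i = (diaS M d).card := by omega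
    refine ⟨by omega, by omega, ?_, ?_⟩
    · by_cases h : d = 1
      · exact Or.inl h
      · right
        have := mt (hM.dia (d := d - 1) (by omega) (i + 1)).2
          (by rwa [show i + 1 + (d - 1) = i + d by omega])
        omega
    · intro h
      rw [← e]
      exact h4 (by omega)
  · rintro ⟨h0, h1, h2, h3⟩
    refine ⟨((diaS M d).card, (diaS M d).card + d), ⟨(hM.dia hd _).2 ⟨by omega, le_rfl⟩, ?_, ?_, ?_⟩,
      ?_, ?_⟩
    · intro i j h
      exact hM.1 i j (Finset.mem_of_mem_erase h)
    · intro i j hij h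
      refine Finset.mem_erase.2 ⟨?_, hM.2.1 i j hij (Finset.mem_of_mem_erase h)⟩
      intro he
      rw [Prod.mk.injEq] at he
      have := Finset.mem_of_mem_erase h
      rw [show j + 1 = i + (d + 1) by omega] at this
      have := (hM.dia (by omega) _).1 this
      omega
    · intro i j hij h
      refine Finset.mem_erase.2 ⟨?_, hM.2.2 i j hij (Finset.mem_of_mem_erase h)⟩
      intro he
      rw [Prod.mk.injEq] at he
      have h5 := Finset.mem_of_mem_erase h
      by_cases hd1 : d = 1
      · have := hM.1 _ _ h5
        omega
      rw [show j = i + 1 + (d - 1) by omega] at h5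
      have := (hM.dia (by omega) _).1 h5
      omega
    · simp only; omega
    · simp only
      intro h
      exact h3 (by omega)

noncomputable def kap (c : ℕ × ℕ) : ℤ := if c.2 = c.1 + 1 ∧ c.1 % 2 = 1 then 1 else 0

theorem W1 {M : Finset (ℕ × ℕ)} (hM : Idl M) {c : ℕ × ℕ} (hc : c.1 < c.2) (t : ℕ → ℚ) :
    wt (tref c t) M = wt t M + zz t c *
      (((if ∃ a, Addb M a ∧ Same a c then 1 else 0) - (if ∃ b, Remb M b ∧ Same b c then 1 else 0)
        - kap c : ℤ) : ℚ) := by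
  rw [wt_ref hM hc]
  congr 2
  rw [show (((M.filter (fun u => Adj u c)).card : ℚ) - 2 * ((M.filter (fun u => Same u c)).card : ℚ))
    = (((M.filter (fun u => Adj u c)).card - 2 * (M.filter (fun u => Same u c)).card : ℤ) : ℚ) by
    push_cast; rfl]
  congr 1
  obtain ⟨p, q⟩ := c
  obtain ⟨d, hd, rfl⟩ : ∃ d, 1 ≤ d ∧ q = p + d := ⟨q - p, by simp only at hc; omega,
    by simp only at hc; omega⟩
  rw [card_adj p d hd]
  have i1 := interl hM hd
  have i0 := dia_zero hM
  unfold kap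
  by_cases h1 : d = 1
  · subst h1
    rw [card_same1 hM]
    simp only [addEx hM p 1 le_rfl, remEx hM p 1 le_rfl]
    simp only [Nat.sub_self, i0]
    generalize (diaS M 1).card = x at *
    generalize (diaS M (1 + 1)).card = y at *
    clear i0
    push_cast
    simp only [true_or, true_and, true_implies]
    split_ifs <;> omega
  · have i2 := interl hM (d := d - 1) (by omega)
    rw [show d - 1 + 1 = d by omega] at i2
    rw [card_same2 p d (by omega)]
    simp only [addEx hM p d hd, remEx hM p d hd]
    split_ifs <;> omega

theorem add_rem {M : Finset (ℕ × ℕ)} (hM : Idl M) {a b c : ℕ × ℕ} (hc : c.1 < c.2)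
    (ha : Addb M a) (sa : Same a c) (hb : Remb M b) (sb : Same b c) : False := by
  obtain ⟨p, q⟩ := c
  obtain ⟨d, hd, rfl⟩ : ∃ d, 1 ≤ d ∧ q = p + d := ⟨q - p, by simp only at hc; omega,
    by simp only at hc; omega⟩
  have h1 := (addEx hM p d hd).1 ⟨a, ha, sa⟩
  have h2 := (remEx hM p d hd).1 ⟨b, hb, sb⟩
  omega

theorem zz_same {b c : ℕ × ℕ} (hs : Same b c) (t : ℕ → ℚ) : zz t b = zz t c := by
  obtain ⟨h1, h2⟩ := hs
  unfold zz
  by_cases h : c.2 = c.1 + 1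
  · have h3 := h2 h
    rw [if_pos h, if_pos (by omega)]
    congr 2
    rw [neg_one_pow_eq_pow_mod_two, neg_one_pow_eq_pow_mod_two (n := c.2)]
    congr 1
    omega
  · rw [if_neg h, if_neg (by omega), show b.2 - b.1 = c.2 - c.1 by omega]

theorem W2 {M : Finset (ℕ × ℕ)} (hM : Idl M) {b c : ℕ × ℕ} (hc : c.1 < c.2) (t : ℕ → ℚ)
    (hb : Remb M b) (hs : Same b c) :
    wt (tref c t) (M.erase b) = wt t M - zz t c * (kap c : ℚ) := by
  have e : wt (tref c t) (M.erase b) = wt (tref c t) M - zz (tref c t) b := by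
    unfold wt
    rw [← Finset.sum_erase_add _ _ hb.1]
    ring
  have h1 : ¬ ∃ a, Addb M a ∧ Same a c := fun ⟨a, ha, sa⟩ => add_rem hM hc ha sa hb hs
  have h2 : ∃ b, Remb M b ∧ Same b c := ⟨b, hb, hs⟩
  have h3 : ¬ Adj b c := by
    have := hs.1
    unfold Adj
    omega
  rw [e, W1 hM hc, if_neg h1, if_pos h2, zz_ref (hM.1 b.1 b.2 hb.1).2 hc, if_neg h3, if_pos hs,
    zz_same hs]
  push_cast
  ring

theorem Addb.unique {M : Finset (ℕ × ℕ)} {a b c : ℕ × ℕ} (ha : Addb M a)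
    (hb : Addb M b) (sa : Same a c) (sb : Same b c) : a = b := by
  have aux : ∀ i j i' j', Addb M (i, j) → Addb M (i', j') → j + i' = j' + i → ¬ i < i' := by
    intro i j i' j' h1 h2 h3 h4
    have := h1.2.1 i j (Finset.mem_insert_self _ _)
    have h := h2.2.down (Finset.mem_insert_self _ _) this.1 h4.le this.2 (by omega)
    rcases Finset.mem_insert.1 h with h | h
    · rw [Prod.mk.injEq] at h; omega
    · exact h1.1 h
  obtain ⟨i, j⟩ := a
  obtain ⟨i', j'⟩ := b
  have e1 := sa.1
  have e2 := sb.1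
  simp only at e1 e2
  have a1 := aux _ _ _ _ ha hb (by omega)
  have a2 := aux _ _ _ _ hb ha (by omega)
  rw [Prod.mk.injEq]
  omega

theorem exists_corner {L : Finset (ℕ × ℕ)} (hL : Idl L) (hne : L.Nonempty) : ∃ c, Remb L c := by
  obtain ⟨c, hc, hmax⟩ := Finset.exists_max_image L (fun p => p.1 + p.2) hne
  refine ⟨c, hc, fun i j h => hL.1 i j (Finset.mem_of_mem_erase h), fun i j hij h => ?_,
    fun i j hi h => ?_⟩
  · refine Finset.mem_erase.2 ⟨?_, hL.2.1 i j hij (Finset.mem_of_mem_erase h)⟩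
    rintro rfl
    have := hmax _ (Finset.mem_of_mem_erase h)
    simp only at this
    omega
  · refine Finset.mem_erase.2 ⟨?_, hL.2.2 i j hi (Finset.mem_of_mem_erase h)⟩
    rintro rfl
    have := hmax _ (Finset.mem_of_mem_erase h)
    simp only at this
    omega

theorem add_mem {L M : Finset (ℕ × ℕ)} (hL : Idl L) (hML : M ⊆ L) {a c : ℕ × ℕ}
    (hc : Remb L c) (ha : Addb M a) (hs : Same a c) : a ∈ L := by
  obtain ⟨i, j⟩ := a
  obtain ⟨p, q⟩ := c
  have e := hs.1
  simp only at e
  have h1 := ha.2.1 i j (Finset.mem_insert_self _ _)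
  have h2 := hL.1 _ _ hc.1
  rcases Nat.lt_or_ge p i with h | h
  · exfalso
    have := ha.2.down (i := p) (j := q + 1) (Finset.mem_insert_self _ _) h2.1 h.le (by omega)
      (by omega)
    rcases Finset.mem_insert.1 this with h | h
    · rw [Prod.mk.injEq] at h; omega
    · exact hc.right hL (hML h)
  · exact hL.down hc.1 h1.1 h h1.2 (by omega)

theorem swap {M : Finset (ℕ × ℕ)} (hM : Idl M) (a b : ℕ × ℕ) :
    (Addb M a ∧ b ∈ M ∧ Remb (insert a M) b) ↔ (a ≠ b ∧ Addb (M.erase b) a ∧ b ∈ M ∧ Remb M b) := by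
  constructor
  · rintro ⟨ha, hb, hr⟩
    have hab : a ≠ b := fun h => ha.1 (h ▸ hb)
    refine ⟨hab, ⟨fun h => ha.1 (Finset.mem_of_mem_erase h), ?_⟩, hb, hb, ?_⟩
    · rw [← Finset.erase_insert_of_ne hab]
      exact hr.2
    · have : M.erase b = M ∩ (insert a M).erase b := by
        ext x
        simp only [Finset.mem_erase, Finset.mem_inter, Finset.mem_insert]
        tauto
      rw [this]
      exact hM.inter hr.2
  · rintro ⟨hab, ha, hb, hr⟩
    refine ⟨⟨fun h => ha.1 (Finset.mem_erase.2 ⟨hab, h⟩), ?_⟩, hb, Finset.mem_insert_of_mem hb, ?_⟩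
    · have : insert a M = M ∪ insert a (M.erase b) := by
        ext x
        simp only [Finset.mem_erase, Finset.mem_union, Finset.mem_insert]
        tauto
      rw [this]
      exact hM.union ha.2
    · rw [Finset.erase_insert_of_ne hab]
      exact ha.2

theorem chev_aux (n : ℕ) : ∀ (L : Finset (ℕ × ℕ)), L.card = n → Idl L → ∀ (t : ℕ → ℚ)
    (M : Finset (ℕ × ℕ)), Idl M →
    ∑ a ∈ L.filter (fun a => Addb M a), GG L (XX L t) (insert a M) =
      (wt t L - wt t M) * GG L (XX L t) M := by
  induction n with
  | zero =>
    intro L h0 hL t M hM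
    rw [Finset.card_eq_zero] at h0
    subst h0
    by_cases h : M ⊆ ∅
    · rw [Finset.subset_empty] at h
      subst h
      simp
    · rw [GG_zero hL hM h]
      simp
  | succ n ih =>
    intro L hn hL t M hM
    by_cases hML : M ⊆ L
    swap
    · rw [GG_zero hL hM hML, mul_zero]
      refine Finset.sum_eq_zero fun a ha => GG_zero hL (Finset.mem_filter.1 ha).2.2 fun h => hML ?_
      exact (Finset.subset_insert _ _).trans h
    obtain ⟨c, hc⟩ := exists_corner hL (Finset.card_pos.1 (by omega))
    have hclt : c.1 < c.2 := (hL.1 c.1 c.2 hc.1).2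
    have hcard : (L.erase c).card = n := by rw [Finset.card_erase_of_mem hc.1]; omega
    have ssame : Same c c := ⟨by omega, fun _ => rfl⟩
    set G' := GG (L.erase c) (XX L t) with hG'
    have H : ∀ N, Idl N → ∑ a ∈ L.filter (fun a => Addb N a), G' (insert a N) =
        (wt (tref c t) (L.erase c) - wt (tref c t) N) * G' N := by
      intro N hN
      have e : ∀ K, G' K = GG (L.erase c) (XX (L.erase c) (tref c t)) K := fun K =>
        GG_congr hc.2 (XX_ref hL hc t)
      rw [e N, ← ih (L.erase c) hcard hc.2 (tref c t) N hN]
      symm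
      refine (Finset.sum_congr rfl fun a _ => (e _).symm).trans ?_
      apply Finset.sum_subset
      · exact Finset.filter_subset_filter _ (Finset.erase_subset _ _)
      · intro a ha hna
        rw [Finset.mem_filter] at ha hna
        apply GG_zero hc.2 ha.2.2
        intro h
        exact hna ⟨h (Finset.mem_insert_self _ _), ha.2⟩
    rw [GG_rec hL hM hML hc, XX_corner hL hc]
    have s1 : ∀ a ∈ L.filter (fun a => Addb M a), GG L (XX L t) (insert a M) =
        G' (insert a M) + zz t c * ((if Same a c then G' M else 0) +
          ∑ b ∈ M.filter (fun b => Remb (insert a M) b ∧ Same b c), G' ((insert a M).erase b)) := by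
      intro a ha
      rw [Finset.mem_filter] at ha
      obtain ⟨haL, ha⟩ := ha
      rw [GG_rec hL ha.2 (Finset.insert_subset haL hML) hc, XX_corner hL hc, Finset.filter_insert]
      congr 2
      have hr : Remb (insert a M) a := ⟨Finset.mem_insert_self _ _, by
        rwa [Finset.erase_insert ha.1]⟩
      by_cases hs : Same a c
      · rw [if_pos ⟨hr, hs⟩, if_pos hs, Finset.sum_insert, Finset.erase_insert ha.1]
        intro h
        exact ha.1 (Finset.mem_filter.1 h).1
      · rw [if_neg (fun h => hs h.2), if_neg hs, zero_add]
    rw [Finset.sum_congr rfl s1, Finset.sum_add_distrib, ← Finset.mul_sum, Finset.sum_add_distrib,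
      H M hM]
    have s2 : ∑ a ∈ L.filter (fun a => Addb M a),
        ∑ b ∈ M.filter (fun b => Remb (insert a M) b ∧ Same b c), G' ((insert a M).erase b) =
        ∑ b ∈ M.filter (fun b => Remb M b ∧ Same b c),
        ((wt (tref c t) (L.erase c) - wt (tref c t) (M.erase b)) * G' (M.erase b) - G' M) := by
      rw [Finset.sum_comm' (s' := fun b => (L.filter (fun a => Addb (M.erase b) a)).erase b)
        (t' := M.filter (fun b => Remb M b ∧ Same b c))]
      · refine Finset.sum_congr rfl fun b hb => ?_
        rw [Finset.mem_filter] at hb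
        obtain ⟨hbM, hb, hs⟩ := hb
        rw [← H _ hb.2, ← Finset.sum_erase_add (a := b) (L.filter (fun a => Addb (M.erase b) a)),
          Finset.insert_erase hbM, add_sub_cancel_right]
        · refine Finset.sum_congr rfl fun a ha => ?_
          rw [Finset.erase_insert_of_ne (Finset.ne_of_mem_erase ha)]
        · rw [Finset.mem_filter]
          refine ⟨hML hbM, Finset.notMem_erase _ _, ?_⟩
          rwa [Finset.insert_erase hbM]
      · intro a b
        have := swap hM a b
        simp only [Finset.mem_filter, Finset.mem_erase]
        tauto
    rw [s2, W2 hL hclt t hc ssame]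
    have w1 := W1 hM hclt t
    by_cases hR : ∃ b, Remb M b ∧ Same b c
    · obtain ⟨b, hb, hs⟩ := hR
      have hA : ¬ ∃ a, Addb M a ∧ Same a c := fun ⟨a, ha, sa⟩ => add_rem hM hclt ha sa hb hs
      rw [if_neg hA, if_pos ⟨b, hb, hs⟩] at w1
      have e : M.filter (fun b => Remb M b ∧ Same b c) = {b} := by
        ext x
        rw [Finset.mem_filter, Finset.mem_singleton]
        constructor
        · rintro ⟨-, h1, h2⟩
          exact h1.unique hM hb h2 hs
        · rintro rfl
          exact ⟨hb.1, hb, hs⟩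
      have e2 : ∑ a ∈ L.filter (fun a => Addb M a), (if Same a c then G' M else 0) = 0 := by
        refine Finset.sum_eq_zero fun a ha => if_neg fun h => hA ⟨a, (Finset.mem_filter.1 ha).2, h⟩
      rw [e, Finset.sum_singleton, Finset.sum_singleton, e2, W2 hM hclt t hb hs, w1]
      push_cast
      ring
    · have e : M.filter (fun b => Remb M b ∧ Same b c) = ∅ := by
        rw [Finset.filter_eq_empty_iff]
        intro b _ h
        exact hR ⟨b, h⟩
      rw [if_neg hR] at w1
      rw [e, Finset.sum_empty, Finset.sum_empty, w1]
      by_cases hA : ∃ a, Addb M a ∧ Same a c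
      · rw [if_pos hA]
        obtain ⟨a, ha, sa⟩ := hA
        rw [Finset.sum_eq_single a, if_pos sa]
        · push_cast
          ring
        · intro x hx hxa
          apply if_neg
          intro h
          exact hxa ((Finset.mem_filter.1 hx).2.unique ha h sa)
        · intro h
          exact absurd (Finset.mem_filter.2 ⟨add_mem hL hML hc ha sa, ha⟩) h
      · rw [if_neg hA, Finset.sum_eq_zero]
        · push_cast
          ring
        · exact fun a ha => if_neg fun h => hA ⟨a, (Finset.mem_filter.1 ha).2, h⟩

theorem chev {L M : Finset (ℕ × ℕ)} (hL : Idl L) (hM : Idl M) (t : ℕ → ℚ) :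
    ∑ a ∈ L.filter (fun a => Addb M a), GG L (XX L t) (insert a M) =
      (wt t L - wt t M) * GG L (XX L t) M := chev_aux _ L rfl hL t M hM

theorem syt_finite (S : Finset (ℕ × ℕ)) : Finite {T : ℕ × ℕ → ℕ // IsSYT S T} := by
  have hb : ∀ T, IsSYT S T → ∀ p ∈ S, T p < S.card + 1 := by
    intro T hT p hp
    have := Finset.mem_Icc.1 (Finset.mem_coe.1 (hT.1.mapsTo (Finset.mem_coe.2 hp)))
    omega
  refine Finite.of_injective
    (fun T : {T : ℕ × ℕ → ℕ // IsSYT S T} => fun p : S => (⟨T.1 p.1, hb T.1 T.2 p.1 p.2⟩ : Fin (S.card + 1)))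
    ?_
  rintro ⟨T, hT⟩ ⟨T', hT'⟩ h
  apply Subtype.ext
  funext p
  simp only
  by_cases hp : p ∈ S
  · have := congrFun h ⟨p, hp⟩
    simpa using this
  · rw [hT.2.1 p hp, hT'.2.1 p hp]

theorem syt_pos {S : Finset (ℕ × ℕ)} {T : ℕ × ℕ → ℕ} (hT : IsSYT S T) {p : ℕ × ℕ} (hp : p ∈ S) :
    1 ≤ T p ∧ T p ≤ S.card :=
  Finset.mem_Icc.1 (Finset.mem_coe.1 (hT.1.mapsTo (Finset.mem_coe.2 hp)))

noncomputable def upT (S : Finset (ℕ × ℕ)) (T : ℕ × ℕ → ℕ) (p : ℕ × ℕ) : ℕ :=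
  if p ∈ S then T p + 1 else 0

theorem bij_of {S : Finset (ℕ × ℕ)} {T : ℕ × ℕ → ℕ} (h1 : ∀ p ∈ S, 1 ≤ T p ∧ T p ≤ S.card)
    (h2 : ∀ p ∈ S, ∀ q ∈ S, T p = T q → p = q) :
    Set.BijOn T ↑S ↑(Finset.Icc 1 S.card) := by
  have m : Set.MapsTo T ↑S ↑(Finset.Icc 1 S.card) := fun p hp => by
    rw [Finset.mem_coe, Finset.mem_Icc]
    exact h1 p (Finset.mem_coe.1 hp)
  have i : Set.InjOn T ↑S := fun p hp q hq h =>
    h2 p (Finset.mem_coe.1 hp) q (Finset.mem_coe.1 hq) h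
  exact ⟨m, i, Finset.surjOn_of_injOn_of_card_le T m i (by simp)⟩

theorem syt_up {L M : Finset (ℕ × ℕ)} (hL : Idl L) {a : ℕ × ℕ} (haL : a ∈ L)
    (ha : Addb M a) {T : ℕ × ℕ → ℕ} (hT : IsSYT (L \ insert a M) T) :
    IsSYT (L \ M) (upT (L \ M) T) := by
  have haS : a ∈ L \ M := Finset.mem_sdiff.2 ⟨haL, ha.1⟩
  have hS : L \ insert a M = (L \ M).erase a := by
    ext x
    simp only [Finset.mem_sdiff, Finset.mem_insert, Finset.mem_erase]
    tauto
  rw [hS] at hT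
  have hSM : ∀ x ∈ L \ M, x ∈ insert a M → x = a := by
    intro x hx h
    rcases Finset.mem_insert.1 h with h | h
    · exact h
    · exact absurd h (Finset.mem_sdiff.1 hx).2
  have hSlt : ∀ i j, (i, j) ∈ L \ M → 1 ≤ i ∧ i < j := fun i j h =>
    hL.1 i j (Finset.mem_sdiff.1 h).1
  generalize L \ M = S at *
  have hcard := Finset.card_erase_of_mem haS
  have hpos := Finset.card_pos.2 ⟨a, haS⟩
  have h0 : T a = 0 := hT.2.1 a (Finset.notMem_erase _ _)
  have hp : ∀ p ∈ S, p ≠ a → 1 ≤ T p ∧ T p ≤ (S.erase a).card := fun p hp hpa =>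
    syt_pos hT (Finset.mem_erase.2 ⟨hpa, hp⟩)
  refine ⟨bij_of ?_ ?_, ?_, ?_, ?_⟩
  · intro p hpS
    rw [upT, if_pos hpS]
    by_cases hpa : p = a
    · subst hpa; omega
    · have := hp p hpS hpa
      omega
  · intro p hpS q hqS h
    rw [upT, upT, if_pos hpS, if_pos hqS] at h
    by_cases hpa : p = a
    · by_cases hqa : q = a
      · rw [hpa, hqa]
      · have := hp q hqS hqa
        subst hpa
        omega
    · have := hp p hpS hpa
      by_cases hqa : q = a
      · subst hqa
        omega
      · exact hT.1.injOn (Finset.mem_coe.2 (Finset.mem_erase.2 ⟨hpa, hpS⟩))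
          (Finset.mem_coe.2 (Finset.mem_erase.2 ⟨hqa, hqS⟩)) (by omega)
  · intro p hpS
    rw [upT, if_neg hpS]
  · intro i j h1 h2
    rw [upT, upT, if_pos h1, if_pos h2]
    have ne2 : (i, j + 1) ≠ a := by
      rintro rfl
      have := hSM _ h1 (ha.2.2.1 i j (hSlt i j h1).2 (Finset.mem_insert_self _ _))
      simp at this
    by_cases ne1 : (i, j) = a
    · have := hp _ h2 ne2
      rw [ne1]
      omega
    · have := hT.2.2.1 i j (Finset.mem_erase.2 ⟨ne1, h1⟩) (Finset.mem_erase.2 ⟨ne2, h2⟩)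
      omega
  · intro i j h1 h2
    rw [upT, upT, if_pos h1, if_pos h2]
    have ne2 : (i + 1, j) ≠ a := by
      rintro rfl
      have := hSM _ h1 (ha.2.2.2 i j (hSlt i j h1).1 (Finset.mem_insert_self _ _))
      simp at this
    by_cases ne1 : (i, j) = a
    · have := hp _ h2 ne2
      rw [ne1]
      omega
    · have := hT.2.2.2 i j (Finset.mem_erase.2 ⟨ne1, h1⟩) (Finset.mem_erase.2 ⟨ne2, h2⟩)
      omega

theorem syt_down {L M : Finset (ℕ × ℕ)} (hL : Idl L) (hM : Idl M) (hne : (L \ M).Nonempty)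
    {T : ℕ × ℕ → ℕ} (hT : IsSYT (L \ M) T) :
    ∃ a, a ∈ L ∧ Addb M a ∧ ∃ T', IsSYT (L \ insert a M) T' ∧ upT (L \ M) T' = T := by
  have hpos := Finset.card_pos.2 hne
  obtain ⟨a, haS, ha1⟩ := hT.1.surjOn (Finset.mem_coe.2 (Finset.mem_Icc.2 ⟨le_rfl, hpos⟩))
  rw [Finset.mem_coe] at haS
  have haL := (Finset.mem_sdiff.1 haS).1
  have haM := (Finset.mem_sdiff.1 haS).2
  have hS : L \ insert a M = (L \ M).erase a := by
    ext x
    simp only [Finset.mem_sdiff, Finset.mem_insert, Finset.mem_erase]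
    tauto
  refine ⟨a, haL, ⟨haM, ?_, ?_, ?_⟩, fun p => T p - 1, ?_, ?_⟩
  · intro i j h
    rcases Finset.mem_insert.1 h with h | h
    · exact hL.1 i j (h ▸ haL)
    · exact hM.1 i j h
  · intro i j hij h
    apply Finset.mem_insert_of_mem
    rcases Finset.mem_insert.1 h with h | h
    · by_contra hn
      have hm : (i, j) ∈ L \ M := Finset.mem_sdiff.2 ⟨hL.2.1 i j hij (h ▸ haL), hn⟩
      have h1 := hT.2.2.1 i j hm (h ▸ haS)
      have h2 := syt_pos hT hm
      rw [h, ha1] at h1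
      omega
    · exact hM.2.1 i j hij h
  · intro i j hij h
    apply Finset.mem_insert_of_mem
    rcases Finset.mem_insert.1 h with h | h
    · by_contra hn
      have hm : (i, j) ∈ L \ M := Finset.mem_sdiff.2 ⟨hL.2.2 i j hij (h ▸ haL), hn⟩
      have h1 := hT.2.2.2 i j hm (h ▸ haS)
      have h2 := syt_pos hT hm
      rw [h, ha1] at h1
      omega
    · exact hM.2.2 i j hij h
  · rw [hS]
    generalize L \ M = S at *
    have hcard := Finset.card_erase_of_mem haS
    have key : ∀ p ∈ S.erase a, 2 ≤ T p := by
      intro p hp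
      have hpS := Finset.mem_of_mem_erase hp
      have h1 := syt_pos hT hpS
      by_contra h
      have := hT.1.injOn (Finset.mem_coe.2 hpS) (Finset.mem_coe.2 haS) (by omega)
      exact Finset.ne_of_mem_erase hp this
    refine ⟨bij_of ?_ ?_, ?_, ?_, ?_⟩
    · intro p hp
      have := key p hp
      have := syt_pos hT (Finset.mem_of_mem_erase hp)
      omega
    · intro p hp q hq h
      have := key p hp
      have := key q hq
      exact hT.1.injOn (Finset.mem_coe.2 (Finset.mem_of_mem_erase hp))
        (Finset.mem_coe.2 (Finset.mem_of_mem_erase hq)) (by omega)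
    · intro p hp
      by_cases hpa : p = a
      · subst hpa; simp only; omega
      · have := hT.2.1 p (fun h => hp (Finset.mem_erase.2 ⟨hpa, h⟩))
        simp only; omega
    · intro i j h1 h2
      have := hT.2.2.1 i j (Finset.mem_of_mem_erase h1) (Finset.mem_of_mem_erase h2)
      have := key _ h1
      simp only
      omega
    · intro i j h1 h2
      have := hT.2.2.2 i j (Finset.mem_of_mem_erase h1) (Finset.mem_of_mem_erase h2)
      have := key _ h1
      simp only
      omega
  · funext p
    unfold upT
    split_ifs with h
    · have := syt_pos hT h
      change T p - 1 + 1 = T p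
      omega
    · exact (hT.2.1 p h).symm

theorem syt_rec {L M : Finset (ℕ × ℕ)} (hL : Idl L) (hM : Idl M) (hne : (L \ M).Nonempty) :
    Nat.card {T : ℕ × ℕ → ℕ // IsSYT (L \ M) T} =
      ∑ a ∈ L.filter (fun a => Addb M a), Nat.card {T : ℕ × ℕ → ℕ // IsSYT (L \ insert a M) T} := by
  have : ∀ a : {x // x ∈ L.filter (fun a => Addb M a)},
      Finite {T : ℕ × ℕ → ℕ // IsSYT (L \ insert a.1 M) T} := fun a => syt_finite _
  rw [← Finset.sum_coe_sort (L.filter (fun a => Addb M a))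
    (fun a => Nat.card {T : ℕ × ℕ → ℕ // IsSYT (L \ insert a M) T}), ← Nat.card_sigma]
  symm
  apply Nat.card_congr
  refine Equiv.ofBijective (fun x => ⟨upT (L \ M) x.2.1, syt_up hL (Finset.mem_filter.1 x.1.2).1
    (Finset.mem_filter.1 x.1.2).2 x.2.2⟩) ⟨?_, ?_⟩
  · rintro ⟨⟨a, ha⟩, T, hT⟩ ⟨⟨b, hb⟩, T', hT'⟩ h
    simp only [Subtype.mk.injEq] at h
    rw [Finset.mem_filter] at ha hb
    have haS : a ∈ L \ M := Finset.mem_sdiff.2 ⟨ha.1, ha.2.1⟩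
    have hTT : T = T' := by
      funext p
      by_cases hp : p ∈ L \ M
      · have := congrFun h p
        rw [upT, upT, if_pos hp, if_pos hp] at this
        omega
      · have hp' : ∀ x, p ∉ L \ insert x M := fun x hx => hp (by
          rw [Finset.mem_sdiff] at hx ⊢
          exact ⟨hx.1, fun h => hx.2 (Finset.mem_insert_of_mem h)⟩)
        rw [hT.2.1 p (hp' _), hT'.2.1 p (hp' _)]
    subst hTT
    have hab : a = b := by
      by_contra hab
      have h1 : T a = 0 := hT.2.1 a (by simp)
      have h2 := syt_pos hT' (p := a) (by
        rw [Finset.mem_sdiff, Finset.mem_insert]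
        exact ⟨ha.1, fun h => h.elim hab ha.2.1⟩)
      omega
    subst hab
    rfl
  · rintro ⟨T, hT⟩
    obtain ⟨a, haL, ha, T', hT', h⟩ := syt_down hL hM hne hT
    exact ⟨⟨⟨a, Finset.mem_filter.2 ⟨haL, ha⟩⟩, T', hT'⟩, Subtype.ext h⟩

theorem syt_empty : Nat.card {T : ℕ × ℕ → ℕ // IsSYT ∅ T} = 1 := by
  rw [Nat.card_eq_one_iff_unique]
  constructor
  · constructor
    rintro ⟨T, hT⟩ ⟨T', hT'⟩
    apply Subtype.ext
    funext p
    change T p = T' p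
    rw [hT.2.1 p (by simp), hT'.2.1 p (by simp)]
  · exact ⟨⟨fun _ => 0, ⟨by simp, by simp, by simp, by simp⟩⟩⟩

theorem EE_self (L : Finset (ℕ × ℕ)) : EE L L = {L} := by
  ext D
  rw [mem_EE, Finset.mem_singleton]
  constructor
  · rintro ⟨-, h⟩
    induction h with
    | refl => rfl
    | tail _ hs ih =>
      subst ih
      rcases hs with ⟨i, j, -, -, h1, h2, -⟩ | ⟨i, -, h1, h2, -⟩
      · exact absurd h1 h2
      · exact absurd h1 h2
  · rintro rfl
    exact ⟨Finset.Subset.refl _, Relation.ReflTransGen.refl⟩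

theorem wt_cast {M : Finset (ℕ × ℕ)} (hM : Idl M) : wt (fun n => (n : ℚ)) M = M.card := by
  unfold wt
  rw [Finset.card_eq_sum_ones, Nat.cast_sum]
  refine Finset.sum_congr rfl fun p hp => ?_
  have := hM.1 p.1 p.2 hp
  unfold zz
  split_ifs
  · simp
  · simp only
    rw [Nat.cast_sub (show 1 ≤ p.2 - p.1 by omega)]
    simp

theorem XX_cast (L : Finset (ℕ × ℕ)) (k : ℕ) : XX L (fun n => (n : ℚ)) k = (nn L k : ℚ) := by
  unfold XX
  have key : ∀ z : ℤ, 0 ≤ z → ((z.toNat : ℕ) : ℚ) = (z : ℚ) := by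
    intro z hz
    have := Int.toNat_of_nonneg hz
    exact_mod_cast this
  split_ifs with h1 h2
  · exact key _ h1.le
  · simp only
    rw [key (- nn L k) (by omega)]
    simp
  · rw [show nn L k = 0 by omega]
    simp

theorem naruse {L : Finset (ℕ × ℕ)} (hL : Idl L) (n : ℕ) : ∀ M, Idl M → M ⊆ L → (L \ M).card = n →
    (Nat.card {T : ℕ × ℕ → ℕ // IsSYT (L \ M) T} : ℚ) * ∏ p ∈ L, ((nn L p.1 : ℚ) + (nn L p.2 : ℚ)) =
      (Nat.factorial n : ℚ) * GG L (fun k => (nn L k : ℚ)) M := by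
  have hX : (fun k => (nn L k : ℚ)) = XX L (fun n => (n : ℚ)) := by
    funext k
    exact (XX_cast L k).symm
  induction n with
  | zero =>
    intro M hM hML h
    rw [Finset.card_eq_zero] at h
    have : M = L := Finset.Subset.antisymm hML (Finset.sdiff_eq_empty_iff_subset.1 h)
    subst this
    rw [h, syt_empty, GG, EE_self, Finset.sum_singleton]
    simp
  | succ n ih =>
    intro M hM hML h
    rw [syt_rec hL hM (Finset.card_pos.1 (by omega)), Nat.cast_sum, Finset.sum_mul]
    have : ∀ a ∈ L.filter (fun a => Addb M a),
        (Nat.card {T : ℕ × ℕ → ℕ // IsSYT (L \ insert a M) T} : ℚ) *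
          ∏ p ∈ L, ((nn L p.1 : ℚ) + (nn L p.2 : ℚ)) =
        (Nat.factorial n : ℚ) * GG L (fun k => (nn L k : ℚ)) (insert a M) := by
      intro a ha
      rw [Finset.mem_filter] at ha
      have hsub := Finset.insert_subset ha.1 hML
      apply ih _ ha.2.2 hsub
      rw [Finset.card_sdiff_of_subset hML] at h
      rw [Finset.card_sdiff_of_subset hsub, Finset.card_insert_of_notMem ha.2.1]
      omega
    rw [Finset.sum_congr rfl this, ← Finset.mul_sum, hX, chev hL hM, wt_cast hL, wt_cast hM]
    have hc : (L.card : ℚ) - M.card = n + 1 := by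
      have h1 := Finset.card_sdiff_add_card_eq_card hML
      have : L.card = M.card + (n + 1) := by omega
      rw [this]
      push_cast
      ring
    rw [hc, Nat.factorial_succ]
    push_cast
    ring

theorem sp_bound {l : ℕ → ℕ} (hl : IsStrictPartition l) (i : ℕ) :
    l (i + 1) ≠ 0 → l (i + 1) + (i + 1) ≤ l 1 + 1 := by
  induction i with
  | zero => intro _; simp
  | succ i ih =>
    intro h
    have h2 := hl.2 (i + 1) (by omega)
    have h3 : l (i + 1) ≠ 0 := fun h0 => h (h2.1 h0)
    have := ih h3
    have := h2.2 h3
    omega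

theorem sp_bound' {l : ℕ → ℕ} (hl : IsStrictPartition l) {i : ℕ} (hi : 1 ≤ i) (h : l i ≠ 0) :
    l i + i ≤ l 1 + 1 := by
  obtain ⟨k, rfl⟩ : ∃ k, i = k + 1 := ⟨i - 1, by omega⟩
  exact sp_bound hl k h

theorem mem_cellsD {l : ℕ → ℕ} (hl : IsStrictPartition l) {i j : ℕ} :
    (i, j) ∈ cellsD l ↔ 1 ≤ i ∧ i < j ∧ j ≤ l i + i := by
  simp only [cellsD, Finset.mem_filter, Finset.mem_product, Finset.mem_Icc]
  constructor
  · rintro ⟨⟨⟨h1, -⟩, -⟩, h2, h3⟩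
    exact ⟨h1, h2, h3⟩
  · rintro ⟨h1, h2, h3⟩
    have := sp_bound' hl h1 (by omega)
    omega

theorem mem_cellsB {l : ℕ → ℕ} (hl : IsStrictPartition l) {i j : ℕ} :
    (i, j) ∈ cellsB l ↔ 1 ≤ i ∧ i ≤ j ∧ j < l i + i := by
  simp only [cellsB, Finset.mem_filter, Finset.mem_product, Finset.mem_Icc]
  constructor
  · rintro ⟨⟨⟨h1, -⟩, -⟩, h2, h3⟩
    exact ⟨h1, h2, h3⟩
  · rintro ⟨h1, h2, h3⟩
    have := sp_bound' hl h1 (by omega)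
    omega

theorem idl_cellsD {l : ℕ → ℕ} (hl : IsStrictPartition l) : Idl (cellsD l) := by
  refine ⟨fun i j h => ?_, fun i j hij h => ?_, fun i j hi h => ?_⟩
  · rw [mem_cellsD hl] at h
    exact ⟨h.1, h.2.1⟩
  · rw [mem_cellsD hl] at h ⊢
    omega
  · rw [mem_cellsD hl] at h ⊢
    have h2 := hl.2 i hi
    have h3 : l i ≠ 0 := fun h0 => by
      have := h2.1 h0
      omega
    have := h2.2 h3
    omega

theorem row_cellsD {l : ℕ → ℕ} (hl : IsStrictPartition l) {k : ℕ} (hk : 1 ≤ k) :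
    (rowS (cellsD l) k).card = l k := by
  have : rowS (cellsD l) k = Finset.Ioc k (k + l k) := by
    ext j
    rw [mem_rowS, mem_cellsD hl, Finset.mem_Ioc]
    omega
  rw [this, Nat.card_Ioc]
  omega

theorem col_cellsD {l : ℕ → ℕ} (hl : IsStrictPartition l) {k : ℕ} (hk : 2 ≤ k) :
    (colS (cellsD l) k).card = colB l (k - 1) := by
  have : colS (cellsD l) k = ((cellsB l).filter (fun p => p.2 = k - 1)).image Prod.fst := by
    ext i
    rw [mem_colS, mem_cellsD hl]
    simp only [Finset.mem_image, Finset.mem_filter, Prod.exists]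
    constructor
    · rintro ⟨h1, h2, h3⟩
      refine ⟨i, k - 1, ⟨(mem_cellsB hl).2 ⟨h1, by omega, by omega⟩, rfl⟩, rfl⟩
    · rintro ⟨a, b, ⟨h, rfl⟩, rfl⟩
      have := (mem_cellsB hl).1 h
      omega
  rw [this, colB, Finset.card_image_of_injOn]
  intro x hx y hy hxy
  rw [Finset.mem_coe, Finset.mem_filter] at hx hy
  exact Prod.ext hxy (by rw [hx.2, hy.2])

theorem len_iff {l : ℕ → ℕ} (hl : IsStrictPartition l) {j : ℕ} (hj : 1 ≤ j) :
    j ≤ spLength l ↔ l j ≠ 0 := by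
  have hm : ∀ x, x ∈ (Finset.Icc 1 (l 1)).filter (fun i => l i ≠ 0) ↔ 1 ≤ x ∧ l x ≠ 0 := by
    intro x
    rw [Finset.mem_filter, Finset.mem_Icc]
    constructor
    · rintro ⟨⟨h1, -⟩, h2⟩
      exact ⟨h1, h2⟩
    · rintro ⟨h1, h2⟩
      have := sp_bound' hl h1 h2
      exact ⟨⟨h1, by omega⟩, h2⟩
  have := seg (S := (Finset.Icc 1 (l 1)).filter (fun i => l i ≠ 0)) (k := 0)
    (fun x hx => ((hm x).1 hx).1) (fun x hx h => (hm x).2 ⟨hx, fun h0 =>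
      ((hm _).1 h).2 ((hl.2 x hx).1 h0)⟩) j
  rw [hm, zero_add] at this
  unfold spLength
  constructor
  · intro h
    exact (this.2 ⟨hj, h⟩).2
  · intro h
    exact (this.1 ⟨hj, h⟩).2

theorem nn_pos {l : ℕ → ℕ} (hl : IsStrictPartition l) {k : ℕ} (hk : 1 ≤ k) (h : l k ≠ 0) :
    nn (cellsD l) k = l k := by
  unfold nn
  have r := row_cellsD hl hk
  have := (idl_cellsD hl).col_full hk (by omega)
  omega

theorem hD_eq {l : ℕ → ℕ} (hl : IsStrictPartition l) {p : ℕ × ℕ} (hp : p ∈ cellsD l) :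
    hD l p = nn (cellsD l) p.1 + nn (cellsD l) p.2 ∧ 0 < hD l p := by
  obtain ⟨i, j⟩ := p
  have h := (mem_cellsD hl).1 hp
  have n1 := nn_pos hl h.1 (by omega)
  have li := len_iff hl (j := j) (by omega)
  unfold hD
  simp only
  rw [n1]
  split_ifs with hj
  · rw [nn_pos hl (by omega) (li.1 hj)]
    exact ⟨rfl, by omega⟩
  · have h0 : l j = 0 := by
      by_contra h0
      exact hj (li.2 h0)
    have r := row_cellsD hl (k := j) (by omega)
    have c := col_cellsD hl (k := j) (by omega)
    have := ((idl_cellsD hl).col i j).1 hp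
    unfold nn
    omega

theorem card_cellsD {l : ℕ → ℕ} (hl : IsStrictPartition l) : (cellsD l).card = spSize l := by
  have hm : ∀ p ∈ cellsD l, p.1 ∈ Finset.Icc 1 (l 1) := by
    intro p hp
    have h := (mem_cellsD hl (i := p.1) (j := p.2)).1 hp
    have := sp_bound' hl h.1 (by omega)
    rw [Finset.mem_Icc]
    omega
  rw [Finset.card_eq_sum_card_fiberwise (f := Prod.fst) (t := Finset.Icc 1 (l 1)) hm, spSize]
  refine Finset.sum_congr rfl fun i hi => ?_
  rw [← row_cellsD hl (Finset.mem_Icc.1 hi).1, rowS, Finset.card_image_of_injOn]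
  intro x hx y hy hxy
  rw [Finset.mem_coe, Finset.mem_filter] at hx hy
  exact Prod.ext (by rw [hx.2, hy.2]) hxy

/-- Naruse's hook-length formula, type D. -/
theorem statement5 (l m : ℕ → ℕ) (hl : IsStrictPartition l) (hm : IsStrictPartition m)
    (hsub : cellsD m ⊆ cellsD l) :
    (fD l m : ℚ) =
      (Nat.factorial (spSize l - spSize m) : ℚ) *
        ∑ D ∈ ED l m, ∏ p ∈ cellsD l \ D, ((hD l p : ℚ))⁻¹ := by
  have hL := idl_cellsD hl
  have hM := idl_cellsD hm
  have main := naruse hL _ (cellsD m) hM hsub rfl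
  have hcard : (cellsD l \ cellsD m).card = spSize l - spSize m := by
    rw [Finset.card_sdiff_of_subset hsub, card_cellsD hl, card_cellsD hm]
  rw [hcard] at main
  have hprod : ∀ D, D ⊆ cellsD l →
      ∏ p ∈ D, ((nn (cellsD l) p.1 : ℚ) + (nn (cellsD l) p.2 : ℚ)) = ∏ p ∈ D, (hD l p : ℚ) := by
    intro D hD
    refine Finset.prod_congr rfl fun p hp => ?_
    rw [(hD_eq hl (hD hp)).1]
    push_cast
    rfl
  have hne : ∀ p ∈ cellsD l, (hD l p : ℚ) ≠ 0 := by
    intro p hp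
    have := (hD_eq hl hp).2
    exact_mod_cast this.ne'
  have hP : ∏ p ∈ cellsD l, (hD l p : ℚ) ≠ 0 := Finset.prod_ne_zero_iff.2 hne
  rw [hprod _ (Finset.Subset.refl _)] at main
  have hG : GG (cellsD l) (fun k => (nn (cellsD l) k : ℚ)) (cellsD m) =
      (∑ D ∈ ED l m, ∏ p ∈ cellsD l \ D, ((hD l p : ℚ))⁻¹) * ∏ p ∈ cellsD l, (hD l p : ℚ) := by
    rw [GG, Finset.sum_mul, ED_eq]
    refine Finset.sum_congr rfl fun D hD => ?_
    have hDL := (mem_EE.1 hD).1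
    rw [hprod D hDL, ← Finset.prod_sdiff hDL, ← mul_assoc, ← Finset.prod_mul_distrib,
      Finset.prod_eq_one (s := cellsD l \ D), one_mul]
    intro p hp
    exact inv_mul_cancel₀ (hne p (Finset.mem_sdiff.1 hp).1)
  rw [hG, ← mul_assoc] at main
  exact mul_right_cancel₀ hP main
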